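/- Let x₁ : S^{m} → X and x₂ : S^{n} → X (m, n ≥ 2) be maps whose Whitehead product [x₁, x₂] ∈ π_{m+n-1}(X) has finite order when x₁, x₂ are the two inclusions into X = S^m ∨ S^n. Then S^m × S^n is rationally homotopy equivalent to S^m ∨ S^n ∨ S^{m+n}; since the rational cohomology ring of S^m × S^n has a nonzero cup product of positive-degree classes while that of S^m ∨ S^n ∨ S^{m+n} has all such cup products zero, this is a contradiction. Hence the Whitehead product of the two sphere inclusions into S^m ∨ S^n has infinite order in π_{m+n-1}(S^m ∨ S^n). -/

import Mathlib

noncomputable section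

open scoped Topology Topology.Homotopy

/-- The wedge identification: glue the two basepoints. -/
def wedgeRel (A B : Type) [TopologicalSpace A] [TopologicalSpace B] (a₀ : A) (b₀ : B) :
    A ⊕ B → A ⊕ B → Prop := fun u v => u = Sum.inl a₀ ∧ v = Sum.inr b₀

/-- The wedge `A ∨ B` of two pointed spaces. -/
def Wedge (A B : Type) [TopologicalSpace A] [TopologicalSpace B] (a₀ : A) (b₀ : B) : Type :=
  Quot (wedgeRel A B a₀ b₀)

instance (A B : Type) [TopologicalSpace A] [TopologicalSpace B] (a₀ : A) (b₀ : B) :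
    TopologicalSpace (Wedge A B a₀ b₀) := instTopologicalSpaceQuot

/-- The basepoint of the wedge. -/
def Wedge.pt {A B : Type} [TopologicalSpace A] [TopologicalSpace B] (a₀ : A) (b₀ : B) :
    Wedge A B a₀ b₀ := Quot.mk _ (Sum.inl a₀)

/-- The inclusion of the first wedge summand. -/
def Wedge.inl {A B : Type} [TopologicalSpace A] [TopologicalSpace B] (a₀ : A) (b₀ : B)
    (a : A) : Wedge A B a₀ b₀ := Quot.mk _ (Sum.inl a)

/-- The inclusion of the second wedge summand. -/
def Wedge.inr {A B : Type} [TopologicalSpace A] [TopologicalSpace B] (a₀ : A) (b₀ : B)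
    (b : B) : Wedge A B a₀ b₀ := Quot.mk _ (Sum.inr b)

/-- The unit sphere `S^k ⊆ ℝ^{k+1}`. -/
def Sph (k : ℕ) : Type := Metric.sphere (0 : EuclideanSpace ℝ (Fin (k + 1))) 1

instance (k : ℕ) : TopologicalSpace (Sph k) := by unfold Sph; infer_instance

/-- The identifications building the mapping cone of (the spherical map underlying) a generalized
loop `γ : I^N → W`: the cell `e^{N+1}` is the cone on `S^N = I^N/∂I^N`, glued to `W` along `γ`.
We collapse the cone point (`t = 0`), collapse the boundary cylinder `∂I^N × I` to the segment
over the basepoint, and attach the top (`t = 1`) via `γ`. -/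
def coneRel {N : ℕ} {W : Type} [TopologicalSpace W] {w₀ : W}
    (γ : GenLoop (Fin N) W w₀) :
    ((Fin N → unitInterval) × unitInterval) ⊕ W →
      ((Fin N → unitInterval) × unitInterval) ⊕ W → Prop := fun u v =>
  (∃ z z', u = Sum.inl (z, 0) ∧ v = Sum.inl (z', 0)) ∨
  (∃ z z' t, z ∈ Cube.boundary (Fin N) ∧ z' ∈ Cube.boundary (Fin N) ∧
      u = Sum.inl (z, t) ∧ v = Sum.inl (z', t)) ∨
  (∃ z, u = Sum.inl (z, 1) ∧ v = Sum.inr (γ.1 z))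

/-- The mapping cone `W ∪_γ e^{N+1}` of a generalized loop `γ`. -/
def MappingCone {N : ℕ} {W : Type} [TopologicalSpace W] {w₀ : W}
    (γ : GenLoop (Fin N) W w₀) : Type := Quot (coneRel γ)

instance {N : ℕ} {W : Type} [TopologicalSpace W] {w₀ : W}
    (γ : GenLoop (Fin N) W w₀) : TopologicalSpace (MappingCone γ) :=
  instTopologicalSpaceQuot

/-- The canonical inclusion `W → W ∪_γ e^{N+1}`. -/
def MappingCone.incl {N : ℕ} {W : Type} [TopologicalSpace W] {w₀ : W}
    (γ : GenLoop (Fin N) W w₀) (w : W) : MappingCone γ := Quot.mk _ (Sum.inr w)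

section Degree

open Set MeasureTheory Metric Topology

variable {E : Type*} [NormedAddCommGroup E] [NormedSpace ℝ E] [FiniteDimensional ℝ E]
  [MeasurableSpace E] [BorelSpace E] (μ : Measure E) [μ.IsAddHaarMeasure]

/-- A `C¹` perturbation of a large multiple of the identity, supported in a ball, scales the
volume of the ball exactly like that multiple of the identity. -/
theorem exists_forall_setIntegral_det_smul_id_add_fderiv {G : E → E} (hG : ContDiff ℝ 1 G)
    (hc : HasCompactSupport G) {R : ℝ} (hR : tsupport G ⊆ closedBall 0 R) :
    ∃ s₀ : ℝ, ∀ s, s₀ ≤ s →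
      ∫ x in closedBall 0 R, (s • ContinuousLinearMap.id ℝ E + fderiv ℝ G x).det ∂μ =
        s ^ Module.finrank ℝ E * μ.real (closedBall 0 R) := by
  obtain ⟨C, hC⟩ := hG.lipschitzWith_of_hasCompactSupport hc one_ne_zero
  have hdet : ∀ᶠ A : E →L[ℝ] E in 𝓝 0, 0 < (ContinuousLinearMap.id ℝ E + A).det := by
    have : ContinuousAt (fun A : E →L[ℝ] E => (ContinuousLinearMap.id ℝ E + A).det) 0 :=
      (ContinuousLinearMap.continuous_det.comp (by fun_prop)).continuousAt
    refine this.eventually_const_lt ?_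
    simp [ContinuousLinearMap.det]
  obtain ⟨δ, hδ, hball⟩ := Metric.eventually_nhds_iff.1 hdet
  refine ⟨max ((C : ℝ) + 1) ((C + 1) / δ), fun s hs => ?_⟩
  have hC0 : (0 : ℝ) ≤ C := C.2
  have hs1 : (C : ℝ) + 1 ≤ s := (le_max_left _ _).trans hs
  have hs2 : (C + 1) / δ ≤ s := (le_max_right _ _).trans hs
  have hs0 : 0 < s := by linarith
  set f : E → E := fun x => x + s⁻¹ • G x with hf
  have hff : ∀ x, HasFDerivAt f (ContinuousLinearMap.id ℝ E + s⁻¹ • fderiv ℝ G x) x := fun x =>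
    (hasFDerivAt_id x).add (((hG.differentiable one_ne_zero) x).hasFDerivAt.const_smul s⁻¹)
  have happ : ApproximatesLinearOn f (ContinuousLinearEquiv.refl ℝ E : E →L[ℝ] E) univ
      (‖s⁻¹‖₊ * C) := by
    intro x _ y _
    have : f x - f y - (ContinuousLinearEquiv.refl ℝ E : E →L[ℝ] E) (x - y) =
        s⁻¹ • (G x - G y) := by
      simp only [hf, ContinuousLinearEquiv.coe_refl, ContinuousLinearMap.coe_id', id, smul_sub]
      abel
    rw [this, norm_smul]
    push_cast
    rw [mul_assoc]
    gcongr
    exact hC.norm_sub_le x y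
  have hlt : Subsingleton E ∨ ‖s⁻¹‖₊ * C <
      ‖((ContinuousLinearEquiv.refl ℝ E).symm : E →L[ℝ] E)‖₊⁻¹ := by
    rcases subsingleton_or_nontrivial E with h | h
    · exact Or.inl h
    · right
      have : ‖((ContinuousLinearEquiv.refl ℝ E).symm : E →L[ℝ] E)‖₊ = 1 := by
        simp
      rw [this, inv_one, ← NNReal.coe_lt_coe]
      push_cast
      rw [Real.norm_eq_abs, abs_of_pos (inv_pos.2 hs0), inv_mul_lt_iff₀ hs0]
      linarith
  have hinj : Function.Injective f := fun x y h => happ.injOn hlt (mem_univ x) (mem_univ y) h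
  have hsurj : Function.Surjective f := happ.surjective hlt
  have himg : f '' closedBall 0 R = closedBall 0 R := by
    have hcompl : f '' (closedBall 0 R)ᶜ = (closedBall 0 R)ᶜ := by
      have : ∀ x ∈ (closedBall (0 : E) R)ᶜ, f x = x := fun x hx => by
        simp [hf, image_eq_zero_of_notMem_tsupport fun h => hx (hR h)]
      rw [image_congr this, image_id']
    rw [← compl_inj_iff, ← image_compl_eq ⟨hinj, hsurj⟩, hcompl]
  have hpos : ∀ x, 0 < (ContinuousLinearMap.id ℝ E + s⁻¹ • fderiv ℝ G x).det := fun x => by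
    apply hball
    rw [dist_zero_right, norm_smul, Real.norm_eq_abs, abs_of_pos (inv_pos.2 hs0),
      inv_mul_lt_iff₀ hs0]
    have h1 := norm_fderiv_le_of_lipschitz ℝ (x₀ := x) hC
    rw [div_le_iff₀ hδ] at hs2
    linarith
  have key := integral_image_eq_integral_abs_det_fderiv_smul μ
    (isClosed_closedBall (x := (0 : E)) (ε := R)).measurableSet
    (fun x _ => (hff x).hasFDerivWithinAt) hinj.injOn (fun _ => (1 : ℝ))
  rw [himg] at key
  simp only [integral_const, smul_eq_mul, mul_one, measureReal_restrict_apply MeasurableSet.univ,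
    univ_inter, abs_of_pos (hpos _)] at key
  rw [key, ← integral_const_mul]
  refine integral_congr_ae (Filter.Eventually.of_forall fun x => ?_)
  have : s • ContinuousLinearMap.id ℝ E + fderiv ℝ G x =
      s • (ContinuousLinearMap.id ℝ E + s⁻¹ • fderiv ℝ G x) := by
    rw [smul_add, smul_inv_smul₀ hs0.ne']
  simp only [this]
  simp only [ContinuousLinearMap.det, ContinuousLinearMap.toLinearMap_smul, LinearMap.det_smul]

theorem integral_det_fderiv_eq_zero [Nontrivial E] {G : E → E} (hG : ContDiff ℝ 1 G)
    (hc : HasCompactSupport G) : ∫ x, (fderiv ℝ G x).det ∂μ = 0 := by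
  obtain ⟨R, hR⟩ := hc.isCompact.isBounded.subset_closedBall 0
  obtain ⟨s₀, hs₀⟩ := exists_forall_setIntegral_det_smul_id_add_fderiv μ hG hc hR
  have hfd : Continuous (fderiv ℝ G) := hG.continuous_fderiv one_ne_zero
  have hsupp : ∫ x, (fderiv ℝ G x).det ∂μ = ∫ x in closedBall 0 R, (fderiv ℝ G x).det ∂μ := by
    refine (setIntegral_eq_integral_of_forall_compl_eq_zero fun x hx => ?_).symm
    have : fderiv ℝ G x = 0 := by
      by_contra h
      exact hx (hR (support_fderiv_subset ℝ h))
    rw [this]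
    simp [ContinuousLinearMap.det]
  set D := Module.finrank ℝ E with hD
  have hDpos : 0 < D := Module.finrank_pos
  set v : ℕ → ℝ := fun j => s₀ + j with hv
  have hvinj : Set.InjOn v (Finset.range (D + 1)) := fun i _ j _ h => by simpa [hv] using h
  set l : ℕ → ℝ := fun j => (Lagrange.basis (Finset.range (D + 1)) v j).eval 0 with hl
  have interp : ∀ P : Polynomial ℝ, P.natDegree ≤ D →
      P.eval 0 = ∑ j ∈ Finset.range (D + 1), P.eval (v j) * l j := fun P hP => by
    have := Lagrange.eq_interpolate (f := P) hvinj
      (by rw [Finset.card_range]; exact lt_of_le_of_lt Polynomial.degree_le_natDegree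
            (by exact_mod_cast Nat.lt_succ_of_le hP))
    conv_lhs => rw [this]
    simp [Lagrange.interpolate_apply, Polynomial.eval_finsetSum, hl]
  have hdet : ∀ A : E →L[ℝ] E, A.det =
      ∑ j ∈ Finset.range (D + 1), (v j • ContinuousLinearMap.id ℝ E + A).det * l j := fun A => by
    have h := interp (-(A : E →ₗ[ℝ] E)).charpoly (LinearMap.charpoly_natDegree _).le
    simp only [LinearMap.eval_charpoly, map_zero, sub_neg_eq_add] at h
    rw [zero_add] at h
    rw [ContinuousLinearMap.det, h]
    rfl
  have hpow : ∑ j ∈ Finset.range (D + 1), v j ^ D * l j = 0 := by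
    have h := interp (Polynomial.X ^ D) (by simp)
    simpa [hDpos.ne'] using h.symm
  rw [hsupp]
  simp_rw [hdet (fderiv ℝ G _)]
  rw [integral_finsetSum]
  · simp_rw [integral_mul_const]
    rw [Finset.sum_congr rfl fun j _ => by rw [hs₀ (v j) (by simp [hv])]]
    simp_rw [mul_right_comm _ (μ.real _), ← Finset.sum_mul]
    rw [hpow, zero_mul]
  · intro j _
    refine (Continuous.continuousOn ?_).integrableOn_compact (isCompact_closedBall 0 R)
    exact (ContinuousLinearMap.continuous_det.comp (by fun_prop)).mul continuous_const

end Degree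

section Kernel

open Set MeasureTheory Metric Topology

variable {E : Type*} [NormedAddCommGroup E] [NormedSpace ℝ E] [FiniteDimensional ℝ E]

/-- There is a `C¹` self-map whose Jacobian is nonnegative, positive at the origin, and vanishes
outside a prescribed ball. -/
theorem exists_contDiff_det_fderiv_nonneg [Nontrivial E] {η : ℝ} (hη : 0 < η) :
    ∃ ψ : E → E, ContDiff ℝ 1 ψ ∧ (∀ y, 0 ≤ (fderiv ℝ ψ y).det) ∧
      (∀ y, η ≤ ‖y‖ → (fderiv ℝ ψ y).det = 0) ∧ 0 < (fderiv ℝ ψ 0).det := by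
  let L : E ≃L[ℝ] (Fin (Module.finrank ℝ E) → ℝ) :=
    ContinuousLinearEquiv.ofFinrankEq (by simp)
  obtain ⟨K, hK0, hK⟩ : ∃ K : ℝ, 0 < K ∧ ∀ y, ‖y‖ ≤ K * ‖L y‖ := by
    refine ⟨‖(L.symm : (Fin (Module.finrank ℝ E) → ℝ) →L[ℝ] E)‖ + 1, by positivity, fun y => ?_⟩
    have h := (L.symm : (Fin (Module.finrank ℝ E) → ℝ) →L[ℝ] E).le_opNorm (L y)
    simp only [ContinuousLinearEquiv.coe_coe, ContinuousLinearEquiv.symm_apply_apply] at h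
    nlinarith [norm_nonneg (L y)]
  set σ : ℝ → ℝ := fun u => max 0 (η / K - |u|) with hσ
  have hσc : Continuous σ := by fun_prop
  set s : ℝ → ℝ := fun y => ∫ u in (0 : ℝ)..y, σ u with hs
  have hsd : ∀ y, HasDerivAt s (σ y) y := fun y =>
    intervalIntegral.integral_hasDerivAt_right (hσc.intervalIntegrable _ _)
      hσc.stronglyMeasurable.stronglyMeasurableAtFilter hσc.continuousAt
  have hsC : ContDiff ℝ 1 s := by
    rw [contDiff_one_iff_deriv]
    refine ⟨fun y => (hsd y).differentiableAt, ?_⟩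
    rwa [show deriv s = σ from funext fun y => (hsd y).deriv]
  set ψ₀ : (Fin (Module.finrank ℝ E) → ℝ) → (Fin (Module.finrank ℝ E) → ℝ) :=
    fun y i => s (y i) with hψ₀
  have hψC : ContDiff ℝ 1 ψ₀ := contDiff_pi.2 fun i => hsC.comp (contDiff_apply ℝ ℝ i)
  have hψd : ∀ y, HasFDerivAt ψ₀
      (LinearMap.toContinuousLinearMap (Matrix.toLin' (Matrix.diagonal fun i => σ (y i)))) y := by
    intro y
    rw [hasFDerivAt_pi']
    intro i
    have h := (hsd (y i)).hasFDerivAt.comp y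
      (ContinuousLinearMap.proj (R := ℝ) (φ := fun _ : Fin (Module.finrank ℝ E) => ℝ) i).hasFDerivAt
    refine h.congr_fderiv ?_
    ext z
    simp [Matrix.mulVec_diagonal, mul_comm]
  have hd : ∀ y, (fderiv ℝ (fun x => L.symm (ψ₀ (L x))) y).det = ∏ i, σ (L y i) := by
    intro y
    have h := (L.symm.hasFDerivAt (x := ψ₀ (L y))).comp y
      ((hψd (L y)).comp y (L.hasFDerivAt (x := y)))
    have h2 : fderiv ℝ (fun x => L.symm (ψ₀ (L x))) y = _ := h.fderiv
    rw [h2, ContinuousLinearMap.det]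
    have := LinearMap.det_conj (Matrix.toLin' (Matrix.diagonal fun i => σ (L y i)))
      L.symm.toLinearEquiv
    rw [LinearMap.det_toLin', Matrix.det_diagonal] at this
    rw [← this]
    rfl
  refine ⟨fun x => L.symm (ψ₀ (L x)), L.symm.contDiff.comp (hψC.comp L.contDiff), fun y => ?_,
    fun y hy => ?_, ?_⟩
  · rw [hd]
    exact Finset.prod_nonneg fun i _ => le_max_left _ _
  · rw [hd]
    have h1 : η / K ≤ ‖L y‖ := by
      rw [div_le_iff₀ hK0, mul_comm]
      exact hy.trans (hK y)
    have : ∃ i, η / K ≤ ‖L y i‖ := by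
      by_contra! hcon
      exact absurd h1 (not_le.2 ((pi_norm_lt_iff (by positivity)).2 hcon))
    obtain ⟨i, hi⟩ := this
    refine Finset.prod_eq_zero (Finset.mem_univ i) ?_
    simpa [hσ] using hi
  · rw [hd]
    refine Finset.prod_pos fun i _ => ?_
    simp only [hσ, map_zero, Pi.zero_apply, abs_zero, sub_zero]
    exact lt_max_of_lt_right (by positivity)

/-- A continuous self-map of a finite-dimensional space which is a nonzero constant outside a
compact set, and which near each zero is affine with positive determinant, has no zeros. -/
theorem ne_zero_of_eventually_affine_det_pos {F : E → E} (hF : Continuous F) {v : E}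
    (hv : v ≠ 0) {K : Set E} (hK : IsCompact K) (hFK : ∀ x ∉ K, F x = v)
    (hz : ∀ x, F x = 0 → ∃ A : E →L[ℝ] E, 0 < A.det ∧ ∃ b, ∀ᶠ y in 𝓝 x, F y = A y + b)
    (x : E) : F x ≠ 0 := by
  intro hx
  have : Nontrivial E := ⟨v, 0, hv⟩
  set U : Set E := {x | ∃ A : E →L[ℝ] E, 0 < A.det ∧ ∃ b, ∀ᶠ y in 𝓝 x, F y = A y + b} with hU
  have hUo : IsOpen U := by
    rw [isOpen_iff_mem_nhds]
    rintro y ⟨A, hA, b, hb⟩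
    filter_upwards [hb.eventually_nhds] with z hz
    exact ⟨A, hA, b, hz⟩
  have hUd : ∀ y ∈ U, 0 < (fderiv ℝ F y).det := by
    rintro y ⟨A, hA, b, hb⟩
    rw [Filter.EventuallyEq.fderiv_eq (f := fun y => A y + b) hb, fderiv_add_const,
      A.hasFDerivAt.fderiv]
    exact hA
  have hUC : ContDiffOn ℝ 1 F U := by
    rintro y ⟨A, hA, b, hb⟩
    exact (ContDiffAt.congr_of_eventuallyEq (f := fun y => A y + b)
      (by fun_prop) hb).contDiffWithinAt
  have hZK : {y | F y = 0} ⊆ K := fun y hy => by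
    by_contra h
    exact hv ((hFK y h).symm.trans hy)
  have hZ : IsCompact {y | F y = 0} :=
    hK.of_isClosed_subset (isClosed_eq hF continuous_const) hZK
  obtain ⟨S, hSc, hZS, hSU⟩ := exists_compact_between hZ hUo hz
  obtain ⟨η, hη, hηF⟩ : ∃ η > 0, ∀ y ∉ interior S, 2 * η ≤ ‖F y‖ := by
    obtain ⟨c, hc, hcF⟩ : ∃ c > 0, ∀ y ∈ K \ interior S, c ≤ ‖F y‖ := by
      rcases (K \ interior S).eq_empty_or_nonempty with h | h
      · exact ⟨1, one_pos, by simp [h]⟩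
      · obtain ⟨y, hy, hmin⟩ := (hK.diff isOpen_interior).exists_isMinOn h hF.norm.continuousOn
        exact ⟨‖F y‖, norm_pos_iff.2 fun h0 => hy.2 (hZS h0), fun z hz => hmin hz⟩
    refine ⟨min c ‖v‖ / 2, by positivity, fun y hy => ?_⟩
    rw [mul_div_cancel₀ _ two_ne_zero]
    by_cases hyK : y ∈ K
    · exact (min_le_left _ _).trans (hcF y ⟨hyK, hy⟩)
    · rw [hFK y hyK]
      exact min_le_right _ _
  obtain ⟨g, hgC, hgd, hgS, hgs⟩ := (hF.sub continuous_const).exists_contDiff_approx_and_eqOn 1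
    (f := fun y => F y - v) (ε := fun _ => η) continuous_const (fun _ => hη) hSc.isClosed
    (hUo.mem_nhdsSet.2 hSU) (hUC.sub contDiffOn_const)
  set F' : E → E := fun y => g y + v with hF'
  have hF'C : ContDiff ℝ 1 F' := hgC.add contDiff_const
  have hF'S : EqOn F' F S := fun y hy => by simp [hF', hgS hy]
  have hF'η : ∀ y ∉ interior S, η ≤ ‖F' y‖ := fun y hy => by
    have h1 := hηF y hy
    have h2 := hgd y
    have h3 : dist (g y) (F y - v) = ‖F' y - F y‖ := by
      rw [dist_eq_norm]
      congr 1
      simp only [hF']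
      abel
    rw [h3] at h2
    have h4 := norm_sub_norm_le (F y) (F' y)
    rw [norm_sub_rev] at h4
    linarith
  obtain ⟨ψ, hψC, hψ0, hψη, hψp⟩ := exists_contDiff_det_fderiv_nonneg (E := E) hη
  have hdet : ∀ y, (fderiv ℝ (fun y => ψ (F' y) - ψ v) y).det =
      (fderiv ℝ ψ (F' y)).det * (fderiv ℝ F' y).det := by
    intro y
    have h := (((hψC.differentiable one_ne_zero) (F' y)).hasFDerivAt.comp y
      ((hF'C.differentiable one_ne_zero) y).hasFDerivAt).sub_const (ψ v)
    have h2 : fderiv ℝ (fun y => ψ (F' y) - ψ v) y = _ := h.fderiv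
    rw [h2]
    exact LinearMap.det_comp _ _
  have hF'd : ∀ y ∈ interior S, 0 < (fderiv ℝ F' y).det := fun y hy => by
    have : F' =ᶠ[𝓝 y] F := by
      filter_upwards [isOpen_interior.mem_nhds hy] with z hz
      exact hF'S (interior_subset hz)
    rw [this.fderiv_eq]
    exact hUd y (hSU (interior_subset hy))
  have hnonneg : ∀ y, 0 ≤ (fderiv ℝ (fun y => ψ (F' y) - ψ v) y).det := fun y => by
    rw [hdet]
    by_cases hy : y ∈ interior S
    · exact mul_nonneg (hψ0 _) (hF'd y hy).le
    · rw [hψη _ (hF'η y hy), zero_mul]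
  have hpos : (fderiv ℝ (fun y => ψ (F' y) - ψ v) x).det ≠ 0 := by
    have hxS : x ∈ interior S := hZS hx
    rw [hdet, hF'S (interior_subset hxS), hx]
    exact (mul_pos hψp (hF'd x hxS)).ne'
  have hGC : ContDiff ℝ 1 (fun y => ψ (F' y) - ψ v) := (hψC.comp hF'C).sub contDiff_const
  have hGs : HasCompactSupport (fun y => ψ (F' y) - ψ v) := by
    refine HasCompactSupport.intro hK fun y hy => ?_
    have : g y = 0 := by
      by_contra h
      exact hgs h (by simp [hFK y hy])
    simp [hF', this]
  borelize E
  have hint := integral_det_fderiv_eq_zero (Measure.addHaar : Measure E) hGC hGs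
  have hcont : Continuous fun y => (fderiv ℝ (fun y => ψ (F' y) - ψ v) y).det :=
    ContinuousLinearMap.continuous_det.comp (hGC.continuous_fderiv one_ne_zero)
  have hcs : HasCompactSupport fun y => (fderiv ℝ (fun y => ψ (F' y) - ψ v) y).det :=
    (hGs.fderiv ℝ).comp_left (g := ContinuousLinearMap.det) (by simp [ContinuousLinearMap.det])
  exact (hcont.integral_pos_of_hasCompactSupport_nonneg_nonzero hcs hnonneg hpos).ne' hint

end Kernel

section Cylinder

open Set Topology unitInterval

/-- The boundary of the cylinder `I^ι × I`. -/
def cylBoundary (ι : Type*) : Set ((ι → I) × I) :=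
  {x | x.1 ∈ Cube.boundary ι ∨ x.2 = 0 ∨ x.2 = 1}

/-- A map `h` from the cylinder `I^ι × I` to `(ℝ^ι × ℝ) × ℝ` is *positive at `x`* if either the
first component of `h x` is nonzero, or its last coordinate is `1`, or near `x` the map `h` is given
by a diagonal affine map with positive entries, the last coordinate being `-1`. -/
def PositiveAt {ι : Type*} (h : (ι → I) × I → ((ι → ℝ) × ℝ) × ℝ) (x : (ι → I) × I) : Prop :=
  (h x).1 = 0 → (h x).2 = 1 ∨ ∃ (c : ι → ℝ) (c' : ℝ), (∀ j, 0 < c j) ∧ 0 < c' ∧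
    ∀ᶠ y in 𝓝 x, h y =
      ((fun j => c j * ((y.1 j : ℝ) - x.1 j), c' * ((y.2 : ℝ) - x.2)), -1)

variable {ι : Type*}

/-- The nearest-point retraction of `ℝ^ι × ℝ` onto the cylinder. -/
def cylClamp (x : (ι → ℝ) × ℝ) : (ι → I) × I :=
  (fun j => projIcc 0 1 zero_le_one (x.1 j), projIcc 0 1 zero_le_one x.2)

/-- The inclusion of the cylinder in `ℝ^ι × ℝ`. -/
def cylCoe (x : (ι → I) × I) : (ι → ℝ) × ℝ := (fun j => x.1 j, x.2)

theorem continuous_cylClamp : Continuous (cylClamp : (ι → ℝ) × ℝ → _) := by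
  unfold cylClamp
  have := continuous_projIcc (h := zero_le_one (α := ℝ))
  fun_prop

theorem continuous_cylCoe : Continuous (cylCoe : (ι → I) × I → _) := by
  unfold cylCoe
  fun_prop

theorem cylClamp_cylCoe (x : (ι → I) × I) : cylClamp (cylCoe x) = x := by
  simp [cylClamp, cylCoe, projIcc_val]

theorem cylCoe_cylClamp_of_mem {x : (ι → ℝ) × ℝ} (h₁ : ∀ j, x.1 j ∈ Icc (0 : ℝ) 1)
    (h₂ : x.2 ∈ Icc (0 : ℝ) 1) : cylCoe (cylClamp x) = x := by
  ext j
  · simp [cylCoe, cylClamp, projIcc_of_mem _ (h₁ j)]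
  · simp [cylCoe, cylClamp, projIcc_of_mem _ h₂]

theorem cylClamp_mem_cylBoundary {x : (ι → ℝ) × ℝ} (h : cylCoe (cylClamp x) ≠ x) :
    cylClamp x ∈ cylBoundary ι := by
  have key : ∀ t : ℝ, t ∉ Icc (0 : ℝ) 1 → projIcc 0 1 zero_le_one t = (0 : I) ∨
      projIcc 0 1 zero_le_one t = (1 : I) := fun t ht => by
    rw [mem_Icc, not_and_or, not_le, not_le] at ht
    rcases ht with ht | ht
    · exact Or.inl (projIcc_of_le_left _ ht.le)
    · exact Or.inr (projIcc_of_right_le _ ht.le)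
  by_cases h₁ : ∀ j, x.1 j ∈ Icc (0 : ℝ) 1
  · by_cases h₂ : x.2 ∈ Icc (0 : ℝ) 1
    · exact absurd (cylCoe_cylClamp_of_mem h₁ h₂) h
    · exact Or.inr (key _ h₂)
  · push Not at h₁
    obtain ⟨j, hj⟩ := h₁
    exact Or.inl ⟨j, key _ hj⟩

theorem eventually_cylCoe_cylClamp [Finite ι] {x : (ι → ℝ) × ℝ}
    (h : cylClamp x ∉ cylBoundary ι) : ∀ᶠ y in 𝓝 x, cylCoe (cylClamp y) = y := by
  have hx : cylCoe (cylClamp x) = x := by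
    by_contra hne
    exact h (cylClamp_mem_cylBoundary hne)
  have hclamp := h
  simp only [cylBoundary, Cube.boundary, mem_ofPred_eq, not_or, not_exists] at h
  have aux : ∀ t : I, t ≠ 0 → t ≠ 1 → (t : ℝ) ∈ Ioo (0 : ℝ) 1 := fun t h0 h1 =>
    ⟨unitInterval.pos_iff_ne_zero.2 h0, unitInterval.lt_one_iff_ne_one.2 h1⟩
  have h1 : ∀ᶠ y in 𝓝 x, ∀ j, y.1 j ∈ Ioo (0 : ℝ) 1 := by
    rw [Filter.eventually_all]
    intro j
    have hc : Continuous fun y : (ι → ℝ) × ℝ => y.1 j := by fun_prop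
    refine hc.continuousAt.eventually (isOpen_Ioo.mem_nhds ?_)
    rw [← hx]
    exact aux _ (h.1 j).1 (h.1 j).2
  have h2 : ∀ᶠ y in 𝓝 x, y.2 ∈ Ioo (0 : ℝ) 1 := by
    refine continuous_snd.continuousAt.eventually (isOpen_Ioo.mem_nhds ?_)
    rw [← hx]
    exact aux _ h.2.1 h.2.2
  filter_upwards [h1, h2] with y hy1 hy2
  exact cylCoe_cylClamp_of_mem (fun j => Ioo_subset_Icc_self (hy1 j)) (Ioo_subset_Icc_self hy2)

theorem det_pi_smul_proj [Fintype ι] (c : ι → ℝ) :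
    (ContinuousLinearMap.pi fun j => c j • ContinuousLinearMap.proj (R := ℝ)
      (φ := fun _ : ι => ℝ) j).det = ∏ j, c j := by
  classical
  rw [ContinuousLinearMap.det, ← Matrix.det_diagonal, ← LinearMap.det_toLin']
  congr 1
  ext i j
  simp [Matrix.mulVec_diagonal]

/-- A map on the cylinder which is positive at every point, constant equal to `(0, 1)` on the
boundary, and null-homotopic through nonvanishing maps which are constant on the boundary, has
last coordinate `1` wherever the first component vanishes. -/
theorem snd_eq_one_of_forall_positiveAt [Fintype ι] {H : I × ((ι → I) × I) → ((ι → ℝ) × ℝ) × ℝ}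
    (hH : Continuous H) (hpos : ∀ x, PositiveAt (fun x => H (0, x)) x) (hne : ∀ p, H p ≠ 0)
    (hbd : ∀ x ∈ cylBoundary ι, H (0, x) = (0, 1))
    (hcst : ∀ s, ∀ x ∈ cylBoundary ι, ∀ y ∈ cylBoundary ι, H (s, x) = H (s, y))
    (hnull : ∀ x y, H (1, x) = H (1, y)) (x : (ι → I) × I) (hx : (H (0, x)).1 = 0) :
    (H (0, x)).2 = 1 := by
  by_contra hx1
  set clip : ℝ → I := projIcc 0 1 zero_le_one with hclip
  have hclipc : Continuous clip := continuous_projIcc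
  have clip_le : ∀ t, t ≤ 0 → clip t = 0 := fun t ht => projIcc_of_le_left _ ht
  have clip_ge : ∀ t, 1 ≤ t → clip t = 1 := fun t ht => projIcc_of_right_le _ ht
  have clip_mem : ∀ t, 0 ≤ t → t ≤ 1 → (clip t : ℝ) = t := fun t h0 h1 => by
    simp [hclip, projIcc_of_mem _ (⟨h0, h1⟩ : t ∈ Icc (0 : ℝ) 1)]
  set δ : (ι → ℝ) × ℝ → ℝ := fun y => ‖y - cylCoe (cylClamp y)‖ with hδ
  have hδc : Continuous δ := (continuous_id.sub (continuous_cylCoe.comp continuous_cylClamp)).norm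
  set x₀ : (ι → I) × I := (fun _ => 0, 0) with hx₀
  have hx₀b : x₀ ∈ cylBoundary ι := Or.inr (Or.inl rfl)
  set s : ((ι → ℝ) × ℝ) × ℝ → I := fun p => clip (min (min (-p.2) (2 + p.2)) (1 - δ p.1)) with hs
  have hsc : Continuous s := by fun_prop
  classical
  set K : ((ι → ℝ) × ℝ) × ℝ → ((ι → ℝ) × ℝ) × ℝ := fun p =>
    if -1 ≤ p.2 then H (s p, cylClamp p.1) else H (s p, x₀) with hK
  have hKc : Continuous K := by
    refine Continuous.if_le ?_ ?_ continuous_const continuous_snd ?_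
    · exact hH.comp (hsc.prodMk (continuous_cylClamp.comp continuous_fst))
    · exact hH.comp (hsc.prodMk continuous_const)
    · intro p hp
      by_cases h0 : cylCoe (cylClamp p.1) = p.1
      · have : s p = 1 := by
          apply clip_ge
          simp only [hδ, h0, ← hp]
          norm_num
        rw [this]
        exact hnull _ _
      · exact hcst _ _ (cylClamp_mem_cylBoundary h0) _ hx₀b
  have hKne : ∀ p, K p ≠ 0 := fun p => by
    simp only [hK]
    split_ifs <;> exact hne _
  have hKpos : ∀ p, 0 ≤ p.2 → K p = H (0, cylClamp p.1) := fun p hp => by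
    have : s p = 0 := clip_le _ ((min_le_left _ _).trans ((min_le_left _ _).trans (by linarith)))
    simp only [hK]
    rw [if_pos (by linarith), this]
  set F : ((ι → ℝ) × ℝ) × ℝ → ((ι → ℝ) × ℝ) × ℝ := fun p =>
    ((clip (2 - p.2) : ℝ) • (K p).1, (K p).2 + (clip p.2 : ℝ) * (1 - (K p).2)) with hF
  have hFc : Continuous F := by fun_prop
  have hF01 : ∀ p, K p = (0, 1) → F p = (0, 1) := fun p hp => by simp [hF, hp]
  have hFout : ∀ p ∉ Metric.closedBall (0 : ((ι → ℝ) × ℝ) × ℝ) 2, F p = (0, 1) := by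
    intro p hp
    by_cases h2 : 2 ≤ p.2
    · simp only [hF]
      rw [clip_le _ (by linarith), clip_ge _ (by linarith)]
      simp
    push Not at h2
    by_cases h3 : p.2 ≤ -2
    · apply hF01
      have : s p = 0 := clip_le _
        ((min_le_left _ _).trans ((min_le_right _ _).trans (by linarith)))
      simp only [hK]
      rw [if_neg (by linarith), this]
      exact hbd _ hx₀b
    push Not at h3
    have hp1 : 2 < ‖p.1‖ := by
      by_contra! hcon
      refine hp ?_
      rw [mem_closedBall_zero_iff, Prod.norm_def, max_le_iff]
      exact ⟨hcon, abs_le.2 ⟨h3.le, h2.le⟩⟩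
    have hQ : ‖cylCoe (cylClamp p.1)‖ ≤ 1 := by
      have aux : ∀ t : I, ‖(t : ℝ)‖ ≤ 1 := fun t => by
        rw [Real.norm_eq_abs, abs_of_nonneg t.2.1]
        exact t.2.2
      rw [Prod.norm_def, max_le_iff, pi_norm_le_iff_of_nonneg zero_le_one]
      exact ⟨fun j => aux _, aux _⟩
    have hδ1 : 1 ≤ δ p.1 := by
      have := norm_sub_norm_le p.1 (cylCoe (cylClamp p.1))
      simp only [hδ]
      linarith
    have hb : cylClamp p.1 ∈ cylBoundary ι := cylClamp_mem_cylBoundary fun h => by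
      simp only [hδ, h, sub_self, norm_zero] at hδ1
      linarith
    have hs0 : s p = 0 := clip_le _ ((min_le_right _ _).trans (by linarith))
    apply hF01
    simp only [hK, hs0]
    split_ifs
    · exact hbd _ hb
    · exact hbd _ hx₀b
  have pole_notMem : ∀ y, (H (0, y)).2 ≠ 1 → y ∉ cylBoundary ι := fun y hy hyb =>
    hy (by rw [hbd y hyb])
  refine ne_zero_of_eventually_affine_det_pos hFc (v := (0, 1)) (by simp)
    (isCompact_closedBall _ 2) hFout ?_ (cylCoe x, 1 / 2) ?_
  · rintro ⟨y, t⟩ hyt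
    have ht0 : 0 < t := by
      by_contra! ht
      refine hKne (y, t) ?_
      have h : F (y, t) = K (y, t) := by
        simp only [hF]
        rw [clip_le t ht, clip_ge (2 - t) (by linarith)]
        simp
      rw [← h, hyt]
    have ht1 : t < 1 := by
      by_contra! ht
      have h : (F (y, t)).2 = 1 := by
        simp only [hF]
        rw [clip_ge t ht]
        simp
      rw [hyt] at h
      simp at h
    have hFeq : ∀ p : ((ι → ℝ) × ℝ) × ℝ, p.2 ∈ Ioo (0 : ℝ) 1 → F p =
        ((H (0, cylClamp p.1)).1, (H (0, cylClamp p.1)).2 +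
          p.2 * (1 - (H (0, cylClamp p.1)).2)) := by
      intro p hp
      simp only [hF]
      rw [hKpos p hp.1.le, clip_ge (2 - p.2) (by linarith [hp.2]), clip_mem _ hp.1.le hp.2.le]
      simp
    rw [hFeq _ ⟨ht0, ht1⟩] at hyt
    obtain ⟨hy1, hy2⟩ := Prod.ext_iff.1 hyt
    simp only [Prod.fst_zero, Prod.snd_zero] at hy1 hy2
    have hne1 : (H (0, cylClamp y)).2 ≠ 1 := fun h => by
      rw [h] at hy2
      norm_num at hy2
    have hmem := pole_notMem _ hne1
    obtain ⟨c, c', hc, hc', hloc⟩ := (hpos _ hy1).resolve_left hne1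
    have hm1 : (H (0, cylClamp y)).2 = -1 := congrArg Prod.snd hloc.self_of_nhds
    have ht : t = 1 / 2 := by
      rw [hm1] at hy2
      linarith
    refine ⟨((ContinuousLinearMap.pi fun j => c j • ContinuousLinearMap.proj (R := ℝ)
      (φ := fun _ : ι => ℝ) j).prodMap (c' • ContinuousLinearMap.id ℝ ℝ)).prodMap
      ((2 : ℝ) • ContinuousLinearMap.id ℝ ℝ), ?_, (((fun j => -(c j * y.1 j), -(c' * y.2)), -1)),
      ?_⟩
    · have e1 : ∀ a : ℝ, LinearMap.det ((a • ContinuousLinearMap.id ℝ ℝ : ℝ →L[ℝ] ℝ) :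
          ℝ →ₗ[ℝ] ℝ) = a := fun a => by
        simp
      have e2 := det_pi_smul_proj c
      simp only [ContinuousLinearMap.det] at e2 ⊢
      rw [ContinuousLinearMap.coe_prodMap, LinearMap.det_prodMap, ContinuousLinearMap.coe_prodMap,
        LinearMap.det_prodMap, e1, e1, e2]
      have := Finset.prod_pos fun j (_ : j ∈ Finset.univ) => hc j
      positivity
    · have hcl := eventually_cylCoe_cylClamp hmem
      have hcl0 := hcl.self_of_nhds
      have hloc' := continuous_cylClamp.continuousAt.eventually hloc
      rw [nhds_prod_eq]
      filter_upwards [(hcl.and hloc').prod_mk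
        (isOpen_Ioo.mem_nhds (⟨ht0, ht1⟩ : t ∈ Ioo (0 : ℝ) 1))]
      rintro ⟨z, r⟩ ⟨⟨hz1, hz2⟩, hr⟩
      rw [hFeq _ hr]
      simp only at hz1 hz2 hr ⊢
      rw [hz2]
      have g1 : ∀ j, ((cylClamp z).1 j : ℝ) = z.1 j := fun j =>
        congrFun (congrArg Prod.fst hz1) j
      have g2 : ((cylClamp z).2 : ℝ) = z.2 := congrArg Prod.snd hz1
      have g3 : ∀ j, ((cylClamp y).1 j : ℝ) = y.1 j := fun j =>
        congrFun (congrArg Prod.fst hcl0) j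
      have g4 : ((cylClamp y).2 : ℝ) = y.2 := congrArg Prod.snd hcl0
      ext j
      · simp [g1, g3]
        ring
      · simp [g2, g4]
        ring
      · simp
        ring
  · have hm1 : (H (0, x)).2 = -1 := by
      obtain ⟨c, c', hc, hc', hloc⟩ := (hpos _ hx).resolve_left hx1
      exact congrArg Prod.snd hloc.self_of_nhds
    simp only [hF]
    rw [hKpos _ (by norm_num), cylClamp_cylCoe, clip_mem (1 / 2) (by norm_num) (by norm_num)]
    simp only [hx, hm1, smul_zero]
    ext <;> simp
    norm_num

end Cylinder

section CellMap

open Set Topology unitInterval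

variable {ι : Type*}

theorem PositiveAt.of_snd_eq_one {h : (ι → I) × I → ((ι → ℝ) × ℝ) × ℝ} {x : (ι → I) × I}
    (hx : (h x).2 = 1) : PositiveAt h x := fun _ => Or.inl hx

/-- Positivity is preserved by precomposition with maps that are locally diagonal affine with
positive entries. -/
theorem PositiveAt.comp {h g : (ι → I) × I → ((ι → ℝ) × ℝ) × ℝ}
    {φ : (ι → I) × I → (ι → I) × I} {x : (ι → I) × I} (hh : PositiveAt h (φ x))
    (hφ : ContinuousAt φ x) {d : ι → ℝ} {d' : ℝ} (hd : ∀ j, 0 < d j) (hd' : 0 < d')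
    (hg : ∀ᶠ y in 𝓝 x, g y = h (φ y))
    (h₁ : ∀ᶠ y in 𝓝 x, ∀ j, ((φ y).1 j : ℝ) - (φ x).1 j = d j * ((y.1 j : ℝ) - x.1 j))
    (h₂ : ∀ᶠ y in 𝓝 x, ((φ y).2 : ℝ) - (φ x).2 = d' * ((y.2 : ℝ) - x.2)) :
    PositiveAt g x := by
  intro hx
  have hgx := hg.self_of_nhds
  rw [hgx] at hx ⊢
  refine (hh hx).imp_right ?_
  rintro ⟨c, c', hc, hc', hloc⟩
  refine ⟨fun j => c j * d j, c' * d', fun j => mul_pos (hc j) (hd j), mul_pos hc' hd', ?_⟩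
  filter_upwards [hg, h₁, h₂, hφ.eventually hloc] with y hy1 hy2 hy3 hy4
  rw [hy1, hy4, hy3]
  simp only [hy2, mul_assoc]

/-- The center of the cylinder. -/
def cylCenter : (ι → ℝ) × ℝ := (fun _ => 1 / 2, 1 / 2)

variable [Fintype ι]

/-- The radial cutoff used to define `cellMap`. -/
def cellCutoff (x : (ι → I) × I) : I :=
  projIcc 0 1 zero_le_one (2 - 8 * ‖cylCoe x - cylCenter‖)

/-- The map collapsing the complement of a ball around the center of the cylinder. -/
def cellMap (x : (ι → I) × I) : ((ι → ℝ) × ℝ) × ℝ :=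
  ((cellCutoff x : ℝ) • (cylCoe x - cylCenter), 1 - 2 * (cellCutoff x : ℝ))

theorem continuous_cellMap : Continuous (cellMap : (ι → I) × I → _) := by
  have h1 : Continuous (cellCutoff : (ι → I) × I → I) :=
    continuous_projIcc.comp (by have := continuous_cylCoe (ι := ι); fun_prop)
  have h2 := continuous_cylCoe (ι := ι)
  unfold cellMap
  fun_prop

theorem cellMap_ne_zero (x : (ι → I) × I) : cellMap x ≠ 0 := by
  intro h
  obtain ⟨h1, h2⟩ := Prod.ext_iff.1 h
  simp only [cellMap, Prod.fst_zero, Prod.snd_zero] at h1 h2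
  rcases smul_eq_zero.1 h1 with h3 | h3
  · rw [h3] at h2
    norm_num at h2
  · simp only [cellCutoff, h3, norm_zero] at h2
    rw [projIcc_of_right_le _ (by norm_num)] at h2
    norm_num at h2

theorem cellMap_eq_of_le_norm {x : (ι → I) × I} (h : 1 / 4 ≤ ‖cylCoe x - cylCenter‖) :
    cellMap x = (0, 1) := by
  have : cellCutoff x = 0 := projIcc_of_le_left _ (by linarith)
  simp [cellMap, this]

theorem cellMap_eq_of_fst {x : (ι → I) × I} {j : ι} (h : 1 / 4 ≤ |(x.1 j : ℝ) - 1 / 2|) :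
    cellMap x = (0, 1) :=
  cellMap_eq_of_le_norm <| h.trans <|
    (norm_le_pi_norm (cylCoe x - cylCenter).1 j).trans (norm_fst_le (cylCoe x - cylCenter))

theorem cellMap_eq_of_snd {x : (ι → I) × I} (h : 1 / 4 ≤ |(x.2 : ℝ) - 1 / 2|) :
    cellMap x = (0, 1) :=
  cellMap_eq_of_le_norm <| h.trans (norm_snd_le (cylCoe x - cylCenter))

theorem cylCoe_eq_cylCenter_of_cellMap {x : (ι → I) × I} (h : (cellMap x).1 = 0)
    (h' : (cellMap x).2 ≠ 1) : cylCoe x = cylCenter := by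
  rcases smul_eq_zero.1 h with h3 | h3
  · exact absurd (by simp [cellMap, h3]) h'
  · exact sub_eq_zero.1 h3

theorem cellMap_of_eq_cylCenter {x : (ι → I) × I} (h : cylCoe x = cylCenter) :
    cellMap x = (0, -1) := by
  have : cellCutoff x = 1 := projIcc_of_right_le _ (by simp [h])
  simp only [cellMap, this, h, sub_self, smul_zero]
  norm_num

theorem positiveAt_cellMap (x : (ι → I) × I) : PositiveAt cellMap x := by
  intro hx
  by_cases hx2 : (cellMap x).2 = 1
  · exact Or.inl hx2
  have hxc := cylCoe_eq_cylCenter_of_cellMap hx hx2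
  refine Or.inr ⟨1, 1, fun _ => one_pos, one_pos, ?_⟩
  have hc : ContinuousAt (fun y : (ι → I) × I => ‖cylCoe y - cylCenter‖) x := by
    have := continuous_cylCoe (ι := ι)
    exact Continuous.continuousAt (by fun_prop)
  have : ∀ᶠ y in 𝓝 x, ‖cylCoe y - cylCenter‖ < 1 / 8 :=
    hc.eventually_lt_const (by simp [hxc])
  filter_upwards [this] with y hy
  have h1 : cellCutoff y = 1 := projIcc_of_right_le _ (by linarith)
  simp only [cellMap, h1, ← hxc]
  ext
  · simp [cylCoe]
  · simp [cylCoe]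
  · norm_num

end CellMap

section Collapse

open Set Topology unitInterval

variable {N : ℕ} {W : Type} [TopologicalSpace W] {w₀ : W} (γ : GenLoop (Fin N) W w₀)

theorem MappingCone.continuous_incl : Continuous (MappingCone.incl γ) :=
  continuous_quot_mk.comp continuous_inr

/-- The characteristic map of the cell of the mapping cone. -/
def MappingCone.cell (x : (Fin N → I) × I) : MappingCone γ := Quot.mk _ (Sum.inl x)

theorem MappingCone.continuous_cell : Continuous (MappingCone.cell γ) :=
  continuous_quot_mk.comp continuous_inl

theorem MappingCone.cell_zero (z z' : Fin N → I) :
    MappingCone.cell γ (z, 0) = MappingCone.cell γ (z', 0) :=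
  Quot.sound (Or.inl ⟨z, z', rfl, rfl⟩)

theorem MappingCone.cell_boundary {z z' : Fin N → I} (hz : z ∈ Cube.boundary (Fin N))
    (hz' : z' ∈ Cube.boundary (Fin N)) (t : I) :
    MappingCone.cell γ (z, t) = MappingCone.cell γ (z', t) :=
  Quot.sound (Or.inr (Or.inl ⟨z, z', t, hz, hz', rfl, rfl⟩))

theorem MappingCone.cell_one (z : Fin N → I) :
    MappingCone.cell γ (z, 1) = MappingCone.incl γ (γ z) :=
  Quot.sound (Or.inr (Or.inr ⟨z, rfl, rfl⟩))

/-- The pinch map of the mapping cone, collapsing everything outside a ball in the cell. -/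
def MappingCone.pinch : MappingCone γ → ((Fin N → ℝ) × ℝ) × ℝ :=
  Quot.lift (Sum.elim cellMap fun _ => (0, 1)) <| by
    have hb : ∀ z ∈ Cube.boundary (Fin N), ∀ t, cellMap (z, t) = (0, 1) := by
      rintro z ⟨j, hj⟩ t
      refine cellMap_eq_of_fst (j := j) ?_
      rcases hj with hj | hj <;> simp only [hj] <;> norm_num [abs_of_pos, abs_of_neg]
    rintro _ _ (⟨z, z', rfl, rfl⟩ | ⟨z, z', t, hz, hz', rfl, rfl⟩ | ⟨z, rfl, rfl⟩)
    · simp only [Sum.elim_inl]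
      rw [cellMap_eq_of_snd, cellMap_eq_of_snd] <;> norm_num
    · simp only [Sum.elim_inl]
      rw [hb z hz, hb z' hz']
    · simp only [Sum.elim_inl, Sum.elim_inr]
      rw [cellMap_eq_of_snd]
      norm_num

theorem MappingCone.continuous_pinch : Continuous (MappingCone.pinch γ) :=
  continuous_quot_lift _ (continuous_cellMap.sumElim continuous_const)

theorem MappingCone.pinch_ne_zero (c : MappingCone γ) : MappingCone.pinch γ c ≠ 0 := by
  obtain ⟨x | x, rfl⟩ := Quot.exists_rep c
  · exact cellMap_ne_zero x
  · exact (by simp : ((0, 1) : ((Fin N → ℝ) × ℝ) × ℝ) ≠ 0)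

@[simp]
theorem MappingCone.pinch_cell (x : (Fin N → I) × I) :
    MappingCone.pinch γ (MappingCone.cell γ x) = cellMap x := rfl

end Collapse

section Filling

open Set Topology unitInterval

variable {N : ℕ} {W : Type} [TopologicalSpace W] {w₀ : W} (γ : GenLoop (Fin N) W w₀)

/-- A map to the mapping cone has a pole if it meets the center of the cell. -/
def MappingCone.HasPole (Θ : (Fin N → I) × I → MappingCone γ) : Prop :=
  ∃ x, (pinch γ (Θ x)).1 = 0 ∧ (pinch γ (Θ x)).2 ≠ 1

/-- A filling of a loop `δ` in `W` is a null-homotopy of `δ` in the mapping cone of `γ` which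
crosses the center of the cell only in an orientation preserving way. -/
structure MappingCone.IsFilling (δ : GenLoop (Fin N) W w₀)
    (Θ : GenLoop (Fin N) C(I, MappingCone γ) (.const I (incl γ w₀))) : Prop where
  zero : ∀ z, Θ z 0 = incl γ w₀
  one : ∀ z, Θ z 1 = incl γ (δ z)
  positiveAt : ∀ x, PositiveAt (fun x : (Fin N → I) × I => pinch γ (Θ x.1 x.2)) x

open MappingCone

theorem MappingCone.isFilling_const : IsFilling γ GenLoop.const GenLoop.const where
  zero _ := rfl
  one _ := rfl
  positiveAt _ := .of_snd_eq_one rfl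

theorem GenLoop.transAt_apply {X : Type*} [TopologicalSpace X] {x₀ : X} (i : Fin N)
    (f g : GenLoop (Fin N) X x₀) (z : Fin N → I) :
    GenLoop.transAt i f g z = if (z i : ℝ) ≤ 1 / 2
      then f (Function.update z i <| Set.projIcc 0 1 zero_le_one (2 * z i))
      else g (Function.update z i <| Set.projIcc 0 1 zero_le_one (2 * z i - 1)) := rfl

variable {γ}

theorem MappingCone.IsFilling.transAt {δ δ' : GenLoop (Fin N) W w₀}
    {Θ Θ' : GenLoop (Fin N) C(I, MappingCone γ) (.const I (incl γ w₀))}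
    (h : IsFilling γ δ Θ) (h' : IsFilling γ δ' Θ') (i : Fin N) :
    IsFilling γ (GenLoop.transAt i δ δ') (GenLoop.transAt i Θ Θ') where
  zero z := by
    rw [GenLoop.transAt_apply]
    split_ifs
    · exact h.zero _
    · exact h'.zero _
  one z := by
    rw [GenLoop.transAt_apply, GenLoop.transAt_apply]
    split_ifs
    · exact h.one _
    · exact h'.one _
  positiveAt x := by
    have hci : Continuous fun y : (Fin N → I) × I => (y.1 i : ℝ) := by fun_prop
    have hcp := continuous_projIcc (h := zero_le_one (α := ℝ))
    set d : Fin N → ℝ := Function.update 1 i 2 with hd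
    have hdpos : ∀ j, 0 < d j := fun j => by
      rcases eq_or_ne j i with rfl | hj
      · simp [hd]
      · simp [hd, hj]
    rcases lt_trichotomy ((x.1 i : ℝ)) (1 / 2) with hx | hx | hx
    · have hev : ∀ᶠ y : (Fin N → I) × I in 𝓝 x, (y.1 i : ℝ) < 1 / 2 :=
        hci.continuousAt.eventually_lt_const hx
      refine PositiveAt.comp (φ := fun y => (Function.update y.1 i
        (projIcc 0 1 zero_le_one (2 * y.1 i)), y.2)) (h.positiveAt _) ?_ hdpos one_pos ?_ ?_ ?_
      · refine Continuous.continuousAt (Continuous.prodMk ?_ continuous_snd)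
        exact continuous_fst.update i (by fun_prop)
      · filter_upwards [hev] with y hy
        rw [GenLoop.transAt_apply, if_pos hy.le]
      · have aux : ∀ y : (Fin N → I) × I, (y.1 i : ℝ) < 1 / 2 →
            ((projIcc 0 1 zero_le_one (2 * (y.1 i : ℝ)) : I) : ℝ) = 2 * y.1 i := fun y hy => by
          rw [projIcc_of_mem _ ⟨by linarith [(y.1 i).2.1], by linarith⟩]
        filter_upwards [hev] with y hy j
        rcases eq_or_ne j i with rfl | hj
        · simp only [Function.update_self, hd, aux y hy, aux x hx]
          ring
        · simp [hd, hj]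
      · simp
    · apply PositiveAt.of_snd_eq_one
      rw [GenLoop.transAt_apply, if_pos hx.le, GenLoop.boundary Θ _ ⟨i, Or.inr ?_⟩]
      · rfl
      · rw [Function.update_self]
        exact projIcc_of_right_le _ (by linarith)
    · have hev : ∀ᶠ y : (Fin N → I) × I in 𝓝 x, 1 / 2 < (y.1 i : ℝ) :=
        hci.continuousAt.eventually_const_lt hx
      refine PositiveAt.comp (φ := fun y => (Function.update y.1 i
        (projIcc 0 1 zero_le_one (2 * y.1 i - 1)), y.2)) (h'.positiveAt _) ?_ hdpos one_pos ?_ ?_ ?_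
      · refine Continuous.continuousAt (Continuous.prodMk ?_ continuous_snd)
        exact continuous_fst.update i (by fun_prop)
      · filter_upwards [hev] with y hy
        rw [GenLoop.transAt_apply, if_neg hy.not_ge]
      · have aux : ∀ y : (Fin N → I) × I, 1 / 2 < (y.1 i : ℝ) →
            ((projIcc 0 1 zero_le_one (2 * (y.1 i : ℝ) - 1) : I) : ℝ) = 2 * y.1 i - 1 :=
          fun y hy => by
            rw [projIcc_of_mem _ ⟨by linarith, by linarith [(y.1 i).2.2]⟩]
        filter_upwards [hev] with y hy j
        rcases eq_or_ne j i with rfl | hj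
        · simp only [Function.update_self, hd, aux y hy, aux x hx]
          ring
        · simp [hd, hj]
      · simp

theorem MappingCone.HasPole.transAt
    {Θ : GenLoop (Fin N) C(I, MappingCone γ) (.const I (incl γ w₀))}
    (h : HasPole γ fun x => Θ x.1 x.2)
    (Θ' : GenLoop (Fin N) C(I, MappingCone γ) (.const I (incl γ w₀))) (i : Fin N) :
    HasPole γ fun x => GenLoop.transAt i Θ Θ' x.1 x.2 := by
  obtain ⟨⟨z, t⟩, hz⟩ := h
  have h0 := (z i).2.1
  have h1 := (z i).2.2
  refine ⟨(Function.update z i ⟨z i / 2, by linarith, by linarith⟩, t), ?_⟩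
  have : GenLoop.transAt i Θ Θ' (Function.update z i ⟨z i / 2, by linarith, by linarith⟩) =
      Θ z := by
    rw [GenLoop.transAt_apply, if_pos (by simp; linarith)]
    congr 1
    simp only [Function.update_self, Function.update_idem, mul_div_cancel₀ _ (two_ne_zero (α := ℝ)),
      projIcc_val, Function.update_eq_self]
  simpa only [this] using hz

end Filling

section Zoom

open Set Topology unitInterval

/-- Dilation of the cube about its center by a factor `1 + s`. -/
def cubeZoom {N : ℕ} (s : ℝ) (z : Fin N → I) : Fin N → I :=
  fun j => projIcc 0 1 zero_le_one (1 / 2 + (1 + s) * ((z j : ℝ) - 1 / 2))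

theorem continuous_cubeZoom {N : ℕ} :
    Continuous fun p : ℝ × (Fin N → I) => cubeZoom p.1 p.2 := by
  have hcp := continuous_projIcc (h := zero_le_one (α := ℝ))
  unfold cubeZoom
  fun_prop

theorem cubeZoom_zero {N : ℕ} (z : Fin N → I) : cubeZoom 0 z = z := by
  ext j
  simp [cubeZoom, projIcc_val]

theorem cubeZoom_mem_boundary {N : ℕ} {s : ℝ} (hs : 0 ≤ s) {z : Fin N → I}
    (hz : z ∈ Cube.boundary (Fin N)) : cubeZoom s z ∈ Cube.boundary (Fin N) := by
  obtain ⟨j, hj | hj⟩ := hz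
  · refine ⟨j, Or.inl (projIcc_of_le_left _ ?_)⟩
    simp only [hj, Icc.coe_zero]
    linarith
  · refine ⟨j, Or.inr (projIcc_of_right_le _ ?_)⟩
    simp only [hj, Icc.coe_one]
    linarith

variable {N : ℕ} {W : Type} [TopologicalSpace W] {w₀ : W} (γ : GenLoop (Fin N) W w₀)

/-- The reparametrization of a loop by dilation by `2`. -/
def GenLoop.zoom : GenLoop (Fin N) W w₀ :=
  ⟨⟨fun z => γ (cubeZoom 1 z), by
    have := continuous_cubeZoom (N := N)
    exact γ.1.continuous.comp (this.comp (by fun_prop : Continuous fun z => ((1 : ℝ), z)))⟩,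
    fun _ hz => γ.2 _ (cubeZoom_mem_boundary zero_le_one hz)⟩

theorem GenLoop.homotopic_zoom : GenLoop.Homotopic γ (GenLoop.zoom γ) := by
  refine ⟨⟨⟨⟨fun p => γ (cubeZoom p.1 p.2), ?_⟩, fun z => ?_, fun z => ?_⟩, fun s z hz => ?_⟩⟩
  · exact γ.1.continuous.comp (continuous_cubeZoom.comp
      (by fun_prop : Continuous fun p : I × (Fin N → I) => ((p.1 : ℝ), p.2)))
  · simp [cubeZoom_zero]
  · rfl
  · exact (γ.2 _ (cubeZoom_mem_boundary s.2.1 hz)).trans (γ.2 _ hz).symm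

/-- The distance by which a point is dilated out of the cube. -/
def cubeExcess (z : Fin N → I) : I :=
  projIcc 0 1 zero_le_one
    (2 * ‖fun j => (1 / 2 + 2 * ((z j : ℝ) - 1 / 2)) - (cubeZoom 1 z j : ℝ)‖)

theorem continuous_cubeExcess : Continuous (cubeExcess : (Fin N → I) → I) := by
  have h1 : Continuous fun z : Fin N → I => cubeZoom 1 z :=
    continuous_cubeZoom.comp (by fun_prop : Continuous fun z : Fin N → I => ((1 : ℝ), z))
  exact continuous_projIcc.comp (by fun_prop)

theorem cubeExcess_of_mem_boundary {z : Fin N → I} (hz : z ∈ Cube.boundary (Fin N)) :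
    cubeExcess z = 1 := by
  apply projIcc_of_right_le
  obtain ⟨j, hj⟩ := hz
  have h1 := norm_le_pi_norm
    (fun j => (1 / 2 + 2 * ((z j : ℝ) - 1 / 2)) - (cubeZoom 1 z j : ℝ)) j
  have h2 : 1 / 2 ≤ ‖(1 / 2 + 2 * ((z j : ℝ) - 1 / 2)) - (cubeZoom 1 z j : ℝ)‖ := by
    rcases hj with hj | hj
    · have : cubeZoom 1 z j = 0 := projIcc_of_le_left _ (by simp [hj])
      rw [this, hj]
      norm_num
    · have : cubeZoom 1 z j = 1 := projIcc_of_right_le _ (by simp [hj]; norm_num)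
      rw [this, hj]
      norm_num
  linarith

theorem cubeExcess_eq_zero_or (z : Fin N → I) :
    (cubeExcess z = 0 ∧ ∀ j, (cubeZoom 1 z j : ℝ) = 1 / 2 + 2 * ((z j : ℝ) - 1 / 2)) ∨
      cubeZoom 1 z ∈ Cube.boundary (Fin N) := by
  by_cases h : ∀ j, 1 / 2 + 2 * ((z j : ℝ) - 1 / 2) ∈ Icc (0 : ℝ) 1
  · left
    have : ∀ j, (cubeZoom 1 z j : ℝ) = 1 / 2 + 2 * ((z j : ℝ) - 1 / 2) := fun j => by
      have := h j
      simp only [cubeZoom, one_add_one_eq_two]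
      rw [projIcc_of_mem _ this]
    refine ⟨projIcc_of_le_left _ ?_, this⟩
    simp only [this, sub_self]
    have : (fun _ => 0 : Fin N → ℝ) = 0 := rfl
    simp [this]
  · right
    push Not at h
    obtain ⟨j, hj⟩ := h
    rw [mem_Icc, not_and_or, not_le, not_le] at hj
    refine ⟨j, hj.imp (fun hj => projIcc_of_le_left _ ?_) fun hj => projIcc_of_right_le _ ?_⟩
    · linarith
    · linarith

theorem eventually_cubeExcess_eq_zero {z : Fin N → I} (hz : cubeZoom 1 z ∉ Cube.boundary (Fin N)) :
    ∀ᶠ y in 𝓝 z, cubeExcess y = 0 ∧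
      ∀ j, (cubeZoom 1 y j : ℝ) = 1 / 2 + 2 * ((y j : ℝ) - 1 / 2) := by
  have h1 : Continuous fun z : Fin N → I => cubeZoom 1 z :=
    continuous_cubeZoom.comp (by fun_prop : Continuous fun z : Fin N → I => ((1 : ℝ), z))
  have hcl : IsClosed (Cube.boundary (Fin N)) := by
    have : Cube.boundary (Fin N) = ⋃ j, ({y | y j = 0} ∪ {y | y j = 1}) := by
      ext y
      simp [Cube.boundary]
    rw [this]
    exact isClosed_iUnion_of_finite fun j =>
      (isClosed_eq (by fun_prop) continuous_const).union
        (isClosed_eq (by fun_prop) continuous_const)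
  filter_upwards [h1.continuousAt.eventually (hcl.isOpen_compl.mem_nhds hz)] with y hy
  exact (cubeExcess_eq_zero_or y).resolve_right hy

end Zoom

section Filling

open Set Topology unitInterval MappingCone

variable {N : ℕ} {W : Type} [TopologicalSpace W] {w₀ : W} (γ : GenLoop (Fin N) W w₀)

/-- The underlying map of `zoomFilling`. -/
def MappingCone.zoomFillingFun (x : (Fin N → I) × I) : MappingCone γ :=
  if (x.2 : ℝ) ≤ 1 / 2
  then cell γ (0, max (projIcc 0 1 zero_le_one (1 - 2 * x.2)) (cubeExcess x.1))
  else cell γ (cubeZoom 1 x.1, max (projIcc 0 1 zero_le_one (2 * x.2 - 1)) (cubeExcess x.1))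

theorem MappingCone.continuous_zoomFillingFun [Nonempty (Fin N)] :
    Continuous (zoomFillingFun γ) := by
  have hcp := continuous_projIcc (h := zero_le_one (α := ℝ))
  have he := continuous_cubeExcess (N := N)
  have h1 : Continuous fun z : Fin N → I => cubeZoom 1 z :=
    continuous_cubeZoom.comp (by fun_prop : Continuous fun z : Fin N → I => ((1 : ℝ), z))
  have hc := continuous_cell γ
  unfold zoomFillingFun
  refine Continuous.if_le (by fun_prop) (by fun_prop) (by fun_prop) continuous_const ?_
  intro x hx
  rw [hx, projIcc_of_le_left _ (by norm_num : (1 : ℝ) - 2 * (1 / 2) ≤ 0),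
    projIcc_of_le_left _ (by norm_num : (2 : ℝ) * (1 / 2) - 1 ≤ 0)]
  rcases cubeExcess_eq_zero_or x.1 with h | h
  · rw [h.1]
    exact (congrArg (cell γ) (by simp)).trans
      ((cell_zero γ 0 (cubeZoom 1 x.1)).trans (congrArg (cell γ) (by simp)))
  · exact cell_boundary γ ⟨Classical.arbitrary _, Or.inl rfl⟩ h _

theorem MappingCone.zoomFillingFun_of_mem_boundary {z : Fin N → I}
    (hz : z ∈ Cube.boundary (Fin N)) (t : I) : zoomFillingFun γ (z, t) = incl γ w₀ := by
  have hmax : ∀ s : I, max s 1 = 1 := fun s => max_eq_right le_one'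
  have h0 : (0 : Fin N → I) ∈ Cube.boundary (Fin N) := by
    obtain ⟨j, -⟩ := hz
    exact ⟨j, Or.inl rfl⟩
  simp only [zoomFillingFun, cubeExcess_of_mem_boundary hz, hmax, cell_one]
  rw [GenLoop.boundary γ _ h0, GenLoop.boundary γ _ (cubeZoom_mem_boundary zero_le_one hz),
    ite_self]

/-- The null-homotopy of (a reparametrization of) the attaching map, going once across the
cell. -/
def MappingCone.zoomFilling [Nonempty (Fin N)] :
    GenLoop (Fin N) C(I, MappingCone γ) (.const I (incl γ w₀)) :=
  ⟨(⟨zoomFillingFun γ, continuous_zoomFillingFun γ⟩ : C(_, _)).curry, fun _ hz =>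
    ContinuousMap.ext fun t => zoomFillingFun_of_mem_boundary γ hz t⟩

theorem MappingCone.zoomFilling_apply [Nonempty (Fin N)] (z : Fin N → I) (t : I) :
    zoomFilling γ z t = zoomFillingFun γ (z, t) := rfl

theorem MappingCone.isFilling_zoomFilling [Nonempty (Fin N)] :
    IsFilling γ (GenLoop.zoom γ) (zoomFilling γ) where
  zero z := by
    have h0 : (0 : Fin N → I) ∈ Cube.boundary (Fin N) := ⟨Classical.arbitrary _, Or.inl rfl⟩
    have h1 : projIcc 0 1 zero_le_one (1 - 2 * ((0 : I) : ℝ)) = (1 : I) :=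
      projIcc_of_right_le _ (by simp)
    rw [zoomFilling_apply, zoomFillingFun, if_pos (by simp), h1,
      show max _ (cubeExcess z) = 1 from max_eq_left le_one', cell_one, GenLoop.boundary γ _ h0]
  one z := by
    have h1 : projIcc 0 1 zero_le_one (2 * ((1 : I) : ℝ) - 1) = (1 : I) :=
      projIcc_of_right_le _ (by norm_num)
    rw [zoomFilling_apply, zoomFillingFun, if_neg (by norm_num), h1,
      show max _ (cubeExcess z) = 1 from max_eq_left le_one', cell_one]
    rfl
  positiveAt x := by
    by_cases hx2 : (pinch γ (zoomFillingFun γ x)).2 = 1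
    · exact .of_snd_eq_one hx2
    by_cases hx1 : (pinch γ (zoomFillingFun γ x)).1 ≠ 0
    · exact fun h => absurd h hx1
    push Not at hx1
    rcases le_or_gt (x.2 : ℝ) (1 / 2) with ht | ht
    · refine .of_snd_eq_one ?_
      simp only [zoomFilling_apply, zoomFillingFun]
      rw [if_pos ht, pinch_cell, cellMap_eq_of_fst (j := Classical.arbitrary _)]
      norm_num
    have hcp := continuous_projIcc (h := zero_le_one (α := ℝ))
    have he := continuous_cubeExcess (N := N)
    have h1 : Continuous fun z : Fin N → I => cubeZoom 1 z :=
      continuous_cubeZoom.comp (by fun_prop : Continuous fun z : Fin N → I => ((1 : ℝ), z))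
    have ht' : ∀ᶠ y : (Fin N → I) × I in 𝓝 x, 1 / 2 < (y.2 : ℝ) :=
      (by fun_prop : Continuous fun y : (Fin N → I) × I =>
        (y.2 : ℝ)).continuousAt.eventually_const_lt ht
    simp only [zoomFillingFun, if_neg ht.not_ge, pinch_cell] at hx1 hx2
    have hcen := cylCoe_eq_cylCenter_of_cellMap hx1 hx2
    have hc1 : ∀ j, (cubeZoom 1 x.1 j : ℝ) = 1 / 2 := fun j => congrFun (congrArg Prod.fst hcen) j
    have hc2 : ((max (projIcc 0 1 zero_le_one (2 * (x.2 : ℝ) - 1)) (cubeExcess x.1) : I) : ℝ) =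
      1 / 2 := congrArg Prod.snd hcen
    have hzb : cubeZoom 1 x.1 ∉ Cube.boundary (Fin N) := by
      rintro ⟨j, hj | hj⟩ <;>
      · have := hc1 j
        rw [hj] at this
        norm_num at this
    have hz := continuous_fst.continuousAt.eventually (eventually_cubeExcess_eq_zero hzb)
    have hev : ∀ᶠ y : (Fin N → I) × I in 𝓝 x,
        ((max (projIcc 0 1 zero_le_one (2 * (y.2 : ℝ) - 1)) (cubeExcess y.1) : I) : ℝ) =
          2 * y.2 - 1 := by
      filter_upwards [ht', hz] with y hy1 hy2
      rw [hy2.1, show max _ (0 : I) = _ from max_eq_left nonneg',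
        projIcc_of_mem _ ⟨by linarith, by linarith [y.2.2.2]⟩]
    refine PositiveAt.comp (φ := fun y => (cubeZoom 1 y.1,
      max (projIcc 0 1 zero_le_one (2 * (y.2 : ℝ) - 1)) (cubeExcess y.1))) (positiveAt_cellMap _)
      ?_ (d := fun _ => 2) (d' := 2) (fun _ => two_pos) two_pos ?_ ?_ ?_
    · exact Continuous.continuousAt (by fun_prop)
    · filter_upwards [ht'] with y hy
      simp only [zoomFilling_apply, zoomFillingFun, if_neg hy.not_ge, pinch_cell]
    · filter_upwards [hz] with y hy j
      simp only [hy.2 j, hz.self_of_nhds.2 j]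
      ring
    · filter_upwards [hev] with y hy
      simp only [hy, hev.self_of_nhds]
      ring

theorem MappingCone.hasPole_zoomFilling [Nonempty (Fin N)] :
    HasPole γ fun x => zoomFilling γ x.1 x.2 := by
  refine ⟨(fun _ => ⟨1 / 2, by norm_num, by norm_num⟩, ⟨3 / 4, by norm_num, by norm_num⟩), ?_⟩
  have hz : ∀ j, cubeZoom 1 (fun _ : Fin N => (⟨1 / 2, by norm_num, by norm_num⟩ : I)) j =
      ⟨1 / 2, by norm_num, by norm_num⟩ := fun j => by
    simp only [cubeZoom, sub_self, mul_zero, add_zero]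
    exact projIcc_of_mem _ _
  have he : cubeExcess (fun _ : Fin N => (⟨1 / 2, by norm_num, by norm_num⟩ : I)) = 0 := by
    refine ((cubeExcess_eq_zero_or _).resolve_right ?_).1
    rintro ⟨j, hj | hj⟩ <;>
    · rw [hz j] at hj
      have := congrArg Subtype.val hj
      norm_num at this
  simp only [zoomFilling_apply, zoomFillingFun]
  rw [if_neg (by norm_num), he, show max _ (0 : I) = _ from max_eq_left nonneg', pinch_cell,
    cellMap_of_eq_cylCenter]
  · norm_num
  · ext j
    · exact congrArg Subtype.val (hz j)
    · simp only [cylCoe, cylCenter]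
      rw [projIcc_of_mem _ (by norm_num)]
      norm_num

/-- Every power of the class of the attaching map has a filling, and all but the zeroth have one
with a pole. -/
theorem MappingCone.exists_isFilling_pow [Nonempty (Fin N)] {w : HomotopyGroup (Fin N) W w₀}
    (hw : Quotient.mk _ γ = w) (k : ℕ) :
    ∃ (δ : GenLoop (Fin N) W w₀)
      (Θ : GenLoop (Fin N) C(I, MappingCone γ) (.const I (incl γ w₀))),
      Quotient.mk _ δ = w ^ k ∧ IsFilling γ δ Θ ∧
        (k ≠ 0 → HasPole γ fun x => Θ x.1 x.2) := by
  induction k with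
  | zero => exact ⟨_, _, by rw [pow_zero]; exact HomotopyGroup.one_def.symm,
      isFilling_const γ, by simp⟩
  | succ k ih =>
    obtain ⟨δ, Θ, hδ, hΘ, -⟩ := ih
    have i : Fin N := Classical.arbitrary _
    refine ⟨_, _, ?_, (isFilling_zoomFilling γ).transAt hΘ i,
      fun _ => (hasPole_zoomFilling γ).transAt Θ i⟩
    have h1 : w = Quotient.mk _ (GenLoop.zoom γ) :=
      hw.symm.trans (Quotient.sound (GenLoop.homotopic_zoom γ))
    rw [pow_succ, ← hδ, h1]
    exact (HomotopyGroup.mul_spec (i := i) (p := δ) (q := GenLoop.zoom γ)).symm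

/-- If the class of the attaching map has finite order, there is a spherical class in the mapping
cone which crosses the center of the cell, and does so only in an orientation preserving way. -/
theorem MappingCone.exists_positiveAt_of_isOfFinOrder [Nonempty (Fin N)]
    {w : HomotopyGroup (Fin N) W w₀} (hw : Quotient.mk _ γ = w) (hfin : IsOfFinOrder w) :
    ∃ Ψ : C((Fin N → I) × I, MappingCone γ),
      (∀ x ∈ cylBoundary (Fin N), Ψ x = incl γ w₀) ∧
      (∀ x, PositiveAt (fun x => pinch γ (Ψ x)) x) ∧ HasPole γ Ψ := by
  obtain ⟨k, hk, hpow⟩ := isOfFinOrder_iff_pow_eq_one.1 hfin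
  obtain ⟨δ, Θ, hδ, hΘ, hpole⟩ := exists_isFilling_pow γ hw k
  rw [hpow, HomotopyGroup.one_def] at hδ
  obtain ⟨H⟩ : GenLoop.Homotopic δ GenLoop.const := Quotient.exact hδ
  have hcp := continuous_projIcc (h := zero_le_one (α := ℝ))
  have hH : ∀ s, ∀ z ∈ Cube.boundary (Fin N), H (s, z) = w₀ := fun s z hz =>
    (H.eq_fst s hz).trans (GenLoop.boundary δ z hz)
  set Ψ : (Fin N → I) × I → MappingCone γ := fun x =>
    if (x.2 : ℝ) ≤ 1 / 2 then Θ x.1 (projIcc 0 1 zero_le_one (2 * x.2))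
    else incl γ (H (projIcc 0 1 zero_le_one (2 * x.2 - 1), x.1)) with hΨ
  have hΘc : Continuous fun x : (Fin N → I) × I => Θ x.1 x.2 :=
    ContinuousMap.continuous_uncurry_of_continuous Θ.1
  have hΨc : Continuous Ψ := by
    refine Continuous.if_le ?_ ?_ (by fun_prop) continuous_const ?_
    · exact hΘc.comp (by fun_prop : Continuous fun x : (Fin N → I) × I =>
        (x.1, projIcc 0 1 zero_le_one (2 * (x.2 : ℝ))))
    · exact (continuous_incl γ).comp (H.continuous.comp (by fun_prop))
    · intro x hx
      rw [hx, projIcc_of_right_le _ (by norm_num : (1 : ℝ) ≤ 2 * (1 / 2)),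
        projIcc_of_le_left _ (by norm_num : (2 : ℝ) * (1 / 2) - 1 ≤ 0)]
      exact (hΘ.one x.1).trans (congrArg _ (H.apply_zero x.1).symm)
  refine ⟨⟨Ψ, hΨc⟩, ?_, ?_, ?_⟩
  · rintro ⟨z, t⟩ (hz | ht | ht)
    · simp only [ContinuousMap.coe_mk, hΨ]
      rw [GenLoop.boundary Θ z hz, hH _ _ hz]
      simp
    · simp only at ht
      simp only [ContinuousMap.coe_mk, hΨ, ht]
      rw [if_pos (by simp), projIcc_of_le_left _ (by simp)]
      exact hΘ.zero z
    · simp only at ht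
      simp only [ContinuousMap.coe_mk, hΨ, ht]
      rw [if_neg (by norm_num), projIcc_of_right_le _ (by norm_num)]
      exact congrArg _ (H.apply_one z)
  · intro x
    rcases lt_or_ge (x.2 : ℝ) (1 / 2) with ht | ht
    · have ht' : ∀ᶠ y : (Fin N → I) × I in 𝓝 x, (y.2 : ℝ) < 1 / 2 :=
        (by fun_prop : Continuous fun y : (Fin N → I) × I =>
          (y.2 : ℝ)).continuousAt.eventually_lt_const ht
      have aux : ∀ y : I, (y : ℝ) < 1 / 2 →
          ((projIcc 0 1 zero_le_one (2 * (y : ℝ)) : I) : ℝ) = 2 * y := fun y hy => by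
        rw [projIcc_of_mem _ ⟨by linarith [y.2.1], by linarith⟩]
      refine PositiveAt.comp (φ := fun y => (y.1, projIcc 0 1 zero_le_one (2 * (y.2 : ℝ))))
        (hΘ.positiveAt _) ?_ (d := 1) (d' := 2) (fun _ => one_pos) two_pos ?_ ?_ ?_
      · exact Continuous.continuousAt (by fun_prop)
      · filter_upwards [ht'] with y hy
        simp only [ContinuousMap.coe_mk, hΨ, if_pos hy.le]
      · simp
      · filter_upwards [ht'] with y hy
        simp only [aux _ hy, aux _ ht]
        ring
    · refine .of_snd_eq_one ?_
      simp only [ContinuousMap.coe_mk, hΨ]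
      split_ifs with h
      · rw [projIcc_of_right_le _ (by linarith : (1 : ℝ) ≤ 2 * x.2)]
        exact congrArg (fun c => (pinch γ c).2) (hΘ.one x.1)
      · rfl
  · obtain ⟨⟨z, t⟩, hz⟩ := hpole hk.ne'
    have h0 := t.2.1
    have h1 := t.2.2
    refine ⟨(z, ⟨t / 2, by linarith, by linarith⟩), ?_⟩
    have : Ψ (z, ⟨t / 2, by linarith, by linarith⟩) = Θ z t := by
      simp only [hΨ]
      rw [if_pos (by linarith)]
      simp only [mul_div_cancel₀ _ (two_ne_zero (α := ℝ)), projIcc_val]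
    simpa only [ContinuousMap.coe_mk, this] using hz

end Filling

section GeneralPosition

open Set Topology unitInterval

/-- A nonvanishing map from a product of two compact subsets of Euclidean spaces to a vector space
of large dimension deforms to a map whose restriction to the axes misses a whole line of
directions. -/
theorem exists_approx_avoiding {V₁ V₂ T X Y : Type*}
    [NormedAddCommGroup V₁] [NormedSpace ℝ V₁] [FiniteDimensional ℝ V₁]
    [NormedAddCommGroup V₂] [NormedSpace ℝ V₂] [FiniteDimensional ℝ V₂]
    [NormedAddCommGroup T] [NormedSpace ℝ T] [FiniteDimensional ℝ T]
    [TopologicalSpace X] [TopologicalSpace Y] [CompactSpace X] [CompactSpace Y]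
    {j₁ : X → V₁} {j₂ : Y → V₂} (hj₁ : IsClosedEmbedding j₁) (hj₂ : IsClosedEmbedding j₂)
    (hd₁ : Module.finrank ℝ V₁ + 1 < Module.finrank ℝ T)
    (hd₂ : Module.finrank ℝ V₂ + 1 < Module.finrank ℝ T)
    {A : X × Y → T} (hA : Continuous A) (hA0 : ∀ x, A x ≠ 0) (a₀ : X) (b₀ : Y) :
    ∃ P : X × Y → T, Continuous P ∧ ∃ u : T,
      (∀ x, ∀ s : I, (1 - s : ℝ) • A x + (s : ℝ) • P x ≠ 0) ∧
      (∀ a, ∀ s : I, (1 - s : ℝ) • P (a, b₀) + (s : ℝ) • u ≠ 0) ∧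
      (∀ b, ∀ s : I, (1 - s : ℝ) • P (a₀, b) + (s : ℝ) • u ≠ 0) := by
  have hfr : Module.finrank ℝ T = Module.finrank ℝ (Fin (Module.finrank ℝ T) → ℝ) := by simp
  have : TietzeExtension.{max u_1 u_2} T :=
    TietzeExtension.of_homeo (ContinuousLinearEquiv.ofFinrankEq hfr).toHomeomorph
  have hj : IsClosedEmbedding (Prod.map j₁ j₂) :=
    ⟨hj₁.isEmbedding.prodMap hj₂.isEmbedding, by
      rw [range_prodMap]
      exact hj₁.isClosed_range.prod hj₂.isClosed_range⟩
  obtain ⟨G, hG⟩ := ContinuousMap.exists_extension hj ⟨A, hA⟩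
  have hGA : ∀ x, G (Prod.map j₁ j₂ x) = A x := fun x => DFunLike.congr_fun hG x
  obtain ⟨ε, hε, hεA⟩ : ∃ ε > 0, ∀ x, ε ≤ ‖A x‖ := by
    obtain ⟨x, -, hx⟩ := isCompact_univ.exists_isMinOn ⟨(a₀, b₀), mem_univ _⟩
      hA.norm.continuousOn
    exact ⟨‖A x‖, norm_pos_iff.2 (hA0 x), fun y => hx (mem_univ y)⟩
  obtain ⟨g, hgC, hgd, -⟩ := G.continuous.exists_contDiff_approx 1 (ε := fun _ => ε)
    continuous_const fun _ => hε
  have hPA : ∀ x, ‖g (Prod.map j₁ j₂ x) - A x‖ < ε := fun x => by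
    rw [← hGA, ← dist_eq_norm]
    exact hgd _
  have hP0 : ∀ x, g (Prod.map j₁ j₂ x) ≠ 0 := fun x h => by
    have h1 := hPA x
    rw [h, zero_sub, norm_neg] at h1
    exact h1.not_ge (hεA x)
  have hr₁ : dimH (range fun p : ℝ × V₁ => p.1 • g (p.2, j₂ b₀)) < Module.finrank ℝ T := by
    refine (ContDiff.dimH_range_le ?_).trans_lt ?_
    · have : ContDiff ℝ 1 fun p : ℝ × V₁ => g (p.2, j₂ b₀) :=
        hgC.comp (contDiff_snd.prodMk contDiff_const)
      exact contDiff_fst.smul this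
    · rw [Module.finrank_prod, Module.finrank_self, add_comm]
      exact_mod_cast hd₁
  have hr₂ : dimH (range fun p : ℝ × V₂ => p.1 • g (j₁ a₀, p.2)) < Module.finrank ℝ T := by
    refine (ContDiff.dimH_range_le ?_).trans_lt ?_
    · have : ContDiff ℝ 1 fun p : ℝ × V₂ => g (j₁ a₀, p.2) :=
        hgC.comp (contDiff_const.prodMk contDiff_snd)
      exact contDiff_fst.smul this
    · rw [Module.finrank_prod, Module.finrank_self, add_comm]
      exact_mod_cast hd₂
  obtain ⟨u, hu⟩ := (dense_compl_of_dimH_lt_finrank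
    ((dimH_union _ _).trans_lt (max_lt hr₁ hr₂))).nonempty
  rw [mem_compl_iff, mem_union, not_or] at hu
  have aux : ∀ y : T, y ≠ 0 → (∀ c : ℝ, c • y ≠ u) →
      ∀ s : I, (1 - s : ℝ) • y + (s : ℝ) • u ≠ 0 := by
    intro y hy hyu s hs
    rcases eq_or_ne (s : ℝ) 0 with h0 | h0
    · simp [h0, hy] at hs
    · refine hyu (-((s : ℝ)⁻¹ * (1 - s))) ?_
      rw [neg_smul, mul_smul, eq_neg_of_add_eq_zero_left hs, smul_neg, neg_neg, inv_smul_smul₀ h0]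
  refine ⟨fun x => g (Prod.map j₁ j₂ x), hgC.continuous.comp hj.continuous, u, fun x s hs => ?_,
    fun a => aux _ (hP0 _) fun c hc => hu.1 ⟨(c, j₁ a), hc⟩,
    fun b => aux _ (hP0 _) fun c hc => hu.2 ⟨(c, j₂ b), hc⟩⟩
  have h1 : A x = -((s : ℝ) • (g (Prod.map j₁ j₂ x) - A x)) := by
    rw [eq_neg_iff_add_eq_zero, ← hs, smul_sub, sub_smul, one_smul]
    abel
  have h2 := hεA x
  rw [h1, norm_neg, norm_smul, Real.norm_eq_abs, abs_of_nonneg s.2.1] at h2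
  have h3 := hPA x
  nlinarith [s.2.1, s.2.2, norm_nonneg (g (Prod.map j₁ j₂ x) - A x)]

end GeneralPosition

section NullHomotopy

open Set Topology unitInterval

variable {N : ℕ}

/-- Stretching the `i`-th coordinate of the cylinder by `1 + s` and then translating by `-r`. -/
def cylStretch (i : Fin N) (s r : ℝ) (x : (Fin N → I) × I) : (Fin N → I) × I :=
  (Function.update x.1 i (projIcc 0 1 zero_le_one ((1 + s) * x.1 i - r)), x.2)

theorem continuous_cylStretch (i : Fin N) :
    Continuous fun p : (ℝ × ℝ) × ((Fin N → I) × I) => cylStretch i p.1.1 p.1.2 p.2 := by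
  have hcp := continuous_projIcc (h := zero_le_one (α := ℝ))
  unfold cylStretch
  exact Continuous.prodMk ((by fun_prop : Continuous fun p : (ℝ × ℝ) × ((Fin N → I) × I) =>
    p.2.1).update i (by fun_prop)) (by fun_prop)

theorem cylStretch_zero (i : Fin N) (x : (Fin N → I) × I) : cylStretch i 0 0 x = x := by
  simp [cylStretch, projIcc_val]

theorem cylStretch_mem_cylBoundary (i : Fin N) {s r : ℝ} (hr : 0 ≤ r) (hrs : r ≤ s)
    {x : (Fin N → I) × I} (hx : x ∈ cylBoundary (Fin N)) :
    cylStretch i s r x ∈ cylBoundary (Fin N) := by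
  rcases hx with ⟨j, hj⟩ | hx
  · rcases eq_or_ne j i with rfl | hji
    · refine Or.inl ⟨j, ?_⟩
      simp only [cylStretch, Function.update_self]
      refine hj.imp (fun h => projIcc_of_le_left _ ?_) fun h => projIcc_of_right_le _ ?_
      · simp [h, hr]
      · simp only [h, Icc.coe_one]
        linarith
    · refine Or.inl ⟨j, ?_⟩
      simpa [cylStretch, hji] using hj
  · exact Or.inr hx

theorem cylStretch_mem_cylBoundary_of_le (i : Fin N) {x : (Fin N → I) × I}
    (hx : (x.1 i : ℝ) ≤ 1 / 2) : cylStretch i 1 1 x ∈ cylBoundary (Fin N) := by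
  refine Or.inl ⟨i, Or.inl ?_⟩
  simp only [cylStretch, Function.update_self]
  exact projIcc_of_le_left _ (by linarith)

theorem cylStretch_mem_cylBoundary_of_ge (i : Fin N) {x : (Fin N → I) × I}
    (hx : 1 / 2 ≤ (x.1 i : ℝ)) : cylStretch i 1 0 x ∈ cylBoundary (Fin N) := by
  refine Or.inl ⟨i, Or.inr ?_⟩
  simp only [cylStretch, Function.update_self]
  exact projIcc_of_right_le _ (by linarith)

/-- Maps that take a single value on the boundary of the cylinder. -/
def ConstOnBoundary {Z : Type*} [TopologicalSpace Z] (f : C((Fin N → I) × I, Z)) : Prop :=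
  ∀ x ∈ cylBoundary (Fin N), ∀ y ∈ cylBoundary (Fin N), f x = f y

theorem homotopicWith_constOnBoundary_of_forall_ne_zero {T : Type*} [TopologicalSpace T] [Zero T]
    {F : I × ((Fin N → I) × I) → T} (hF : Continuous F) (hne : ∀ p, F p ≠ 0)
    (hcst : ∀ s, ∀ x ∈ cylBoundary (Fin N), ∀ y ∈ cylBoundary (Fin N), F (s, x) = F (s, y))
    {f g : C((Fin N → I) × I, {v : T // v ≠ 0})} (h₀ : ∀ x, F (0, x) = f x)
    (h₁ : ∀ x, F (1, x) = g x) : ContinuousMap.HomotopicWith f g ConstOnBoundary :=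
  ⟨{ toFun := fun p => ⟨F p, hne p⟩
     continuous_toFun := hF.subtype_mk _
     map_zero_left := fun x => Subtype.ext (h₀ x)
     map_one_left := fun x => Subtype.ext (h₁ x)
     prop' := fun s x hx y hy => Subtype.ext (hcst s x hx y hy) }⟩

/-- A spherical class in a space homotopy equivalent to a product becomes null-homotopic under
a nonvanishing map `q` to a vector space, provided that the map induced by `q` on the product
can be deformed into general position with respect to the axes. -/
theorem homotopicWith_const_of_homotopyEquiv_prod {T C X Y : Type*} [NormedAddCommGroup T]
    [NormedSpace ℝ T] [TopologicalSpace C] [TopologicalSpace X] [TopologicalSpace Y] (i : Fin N)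
    (e : ContinuousMap.HomotopyEquiv C (X × Y)) {q : C → T} (hq : Continuous q)
    (hq0 : ∀ c, q c ≠ 0) (Ψ : C((Fin N → I) × I, C)) (c₀ : C)
    (hΨ : ∀ x ∈ cylBoundary (Fin N), Ψ x = c₀)
    {P : X × Y → T} (hP : Continuous P) {u : T}
    (hAP : ∀ x, ∀ s : I, (1 - s : ℝ) • q (e.invFun x) + (s : ℝ) • P x ≠ 0)
    (hu₁ : ∀ a, ∀ s : I, (1 - s : ℝ) • P (a, (e c₀).2) + (s : ℝ) • u ≠ 0)
    (hu₂ : ∀ b, ∀ s : I, (1 - s : ℝ) • P ((e c₀).1, b) + (s : ℝ) • u ≠ 0) (hu : u ≠ 0) :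
    ContinuousMap.HomotopicWith
      (⟨fun x => ⟨q (Ψ x), hq0 _⟩, (hq.comp Ψ.continuous).subtype_mk _⟩ :
        C((Fin N → I) × I, {v : T // v ≠ 0}))
      (.const _ ⟨u, hu⟩) ConstOnBoundary := by
  have hec : Continuous fun x => e (Ψ x) := e.toFun.continuous.comp Ψ.continuous
  have hqe : Continuous fun x => q (e.invFun x) := hq.comp e.invFun.continuous
  set J : I → ((Fin N → I) × I) → X × Y := fun s x =>
    ((e (Ψ (cylStretch i s 0 x))).1, (e (Ψ (cylStretch i s s x))).2) with hJ
  have hJc : Continuous fun p : I × ((Fin N → I) × I) => J p.1 p.2 := by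
    have h1 : Continuous fun p : I × ((Fin N → I) × I) => cylStretch i p.1 0 p.2 :=
      (continuous_cylStretch i).comp (f := fun p : I × ((Fin N → I) × I) =>
        (((p.1 : ℝ), (0 : ℝ)), p.2)) (by fun_prop)
    have h2 : Continuous fun p : I × ((Fin N → I) × I) => cylStretch i p.1 p.1 p.2 :=
      (continuous_cylStretch i).comp (f := fun p : I × ((Fin N → I) × I) =>
        (((p.1 : ℝ), (p.1 : ℝ)), p.2)) (by fun_prop)
    exact (continuous_fst.comp (hec.comp h1)).prodMk (continuous_snd.comp (hec.comp h2))
  have hJ1c : Continuous (J 1) := hJc.comp (f := fun x => ((1 : I), x)) (Continuous.prodMk_right 1)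
  have hJb : ∀ s, ∀ x ∈ cylBoundary (Fin N), J s x = e c₀ := fun s x hx => by
    simp only [hJ]
    rw [hΨ _ (cylStretch_mem_cylBoundary i le_rfl s.2.1 hx),
      hΨ _ (cylStretch_mem_cylBoundary i s.2.1 le_rfl hx)]
  have hJ0 : ∀ x, J 0 x = e (Ψ x) := fun x => by
    simp [hJ, cylStretch_zero]
  have hJ1 : ∀ x, (J 1 x).2 = (e c₀).2 ∨ (J 1 x).1 = (e c₀).1 := fun x => by
    rcases le_total (x.1 i : ℝ) (1 / 2) with hx | hx
    · left
      simp only [hJ, Icc.coe_one]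
      rw [hΨ _ (cylStretch_mem_cylBoundary_of_le i hx)]
    · right
      simp only [hJ, Icc.coe_one]
      rw [hΨ _ (cylStretch_mem_cylBoundary_of_ge i hx)]
  obtain ⟨L⟩ := e.left_inv.symm
  have s₁ : ContinuousMap.HomotopicWith
      (⟨fun x => ⟨q (Ψ x), hq0 _⟩, (hq.comp Ψ.continuous).subtype_mk _⟩ :
        C((Fin N → I) × I, {v : T // v ≠ 0}))
      ⟨fun x => ⟨q (e.invFun (J 0 x)), hq0 _⟩, by
        simp only [hJ0]
        exact (hqe.comp hec).subtype_mk _⟩ ConstOnBoundary := by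
    refine homotopicWith_constOnBoundary_of_forall_ne_zero
      (F := fun p => q (L (p.1, Ψ p.2))) ?_ (fun _ => hq0 _) ?_ (fun x => ?_) (fun x => ?_)
    · exact hq.comp (L.continuous.comp (by fun_prop))
    · intro s x hx y hy
      simp only [hΨ x hx, hΨ y hy]
    · simp
    · simp [hJ0]
  have s₂ : ContinuousMap.HomotopicWith
      (⟨fun x => ⟨q (e.invFun (J 0 x)), hq0 _⟩, by
        simp only [hJ0]
        exact (hqe.comp hec).subtype_mk _⟩ : C((Fin N → I) × I, {v : T // v ≠ 0}))
      ⟨fun x => ⟨q (e.invFun (J 1 x)), hq0 _⟩, (hqe.comp hJ1c).subtype_mk _⟩ ConstOnBoundary := by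
    refine homotopicWith_constOnBoundary_of_forall_ne_zero
      (F := fun p => q (e.invFun (J p.1 p.2))) (hqe.comp hJc) (fun _ => hq0 _) ?_
      (fun x => rfl) (fun x => rfl)
    intro s x hx y hy
    simp only [hJb s x hx, hJb s y hy]
  have hPne : ∀ x, P x ≠ 0 := fun x => by simpa using hAP x 1
  have s₃ : ContinuousMap.HomotopicWith
      (⟨fun x => ⟨q (e.invFun (J 1 x)), hq0 _⟩, (hqe.comp hJ1c).subtype_mk _⟩ :
        C((Fin N → I) × I, {v : T // v ≠ 0}))
      ⟨fun x => ⟨P (J 1 x), hPne _⟩, (hP.comp hJ1c).subtype_mk _⟩ ConstOnBoundary := by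
    refine homotopicWith_constOnBoundary_of_forall_ne_zero
      (F := fun p => (1 - p.1 : ℝ) • q (e.invFun (J 1 p.2)) + (p.1 : ℝ) • P (J 1 p.2)) ?_
      (fun _ => hAP _ _) ?_ (fun x => by simp) (fun x => by simp)
    · have h1 := hqe.comp hJ1c
      have h2 := hP.comp hJ1c
      simp only [Function.comp_def] at h1 h2
      fun_prop
    · intro s x hx y hy
      simp only [hJb 1 x hx, hJb 1 y hy]
  have s₄ : ContinuousMap.HomotopicWith
      (⟨fun x => ⟨P (J 1 x), hPne _⟩, (hP.comp hJ1c).subtype_mk _⟩ :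
        C((Fin N → I) × I, {v : T // v ≠ 0})) (.const _ ⟨u, hu⟩) ConstOnBoundary := by
    refine homotopicWith_constOnBoundary_of_forall_ne_zero
      (F := fun p => (1 - p.1 : ℝ) • P (J 1 p.2) + (p.1 : ℝ) • u) ?_
      (fun p => ?_) ?_ (fun x => by simp) (fun x => by simp)
    · have h2 := hP.comp hJ1c
      simp only [Function.comp_def] at h2
      fun_prop
    · rcases hJ1 p.2 with h | h
      · have := hu₁ (J 1 p.2).1 p.1
        rwa [← h] at this
      · have := hu₂ (J 1 p.2).2 p.1
        rwa [← h] at this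
    · intro s x hx y hy
      simp only [hJb 1 x hx, hJb 1 y hy]
  exact ((s₁.trans s₂).trans s₃).trans s₄

end NullHomotopy

section Main

open Set Topology unitInterval

/-- If the mapping cone of `γ` is homotopy equivalent to a product of two compact subsets of
Euclidean spaces of dimension at most `N`, then the class of `γ` has infinite order. -/
theorem not_isOfFinOrder_of_homotopyEquiv_prod {N : ℕ} [Nonempty (Fin N)] {W : Type}
    [TopologicalSpace W] {w₀ : W} (γ : GenLoop (Fin N) W w₀) {w : HomotopyGroup (Fin N) W w₀}
    (hw : Quotient.mk _ γ = w) {V₁ V₂ X Y : Type*}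
    [NormedAddCommGroup V₁] [NormedSpace ℝ V₁] [FiniteDimensional ℝ V₁]
    [NormedAddCommGroup V₂] [NormedSpace ℝ V₂] [FiniteDimensional ℝ V₂]
    [TopologicalSpace X] [TopologicalSpace Y] [CompactSpace X] [CompactSpace Y]
    {j₁ : X → V₁} {j₂ : Y → V₂} (hj₁ : IsClosedEmbedding j₁) (hj₂ : IsClosedEmbedding j₂)
    (hd₁ : Module.finrank ℝ V₁ ≤ N) (hd₂ : Module.finrank ℝ V₂ ≤ N)
    (e : ContinuousMap.HomotopyEquiv (MappingCone γ) (X × Y)) : ¬ IsOfFinOrder w := by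
  intro hfin
  obtain ⟨Ψ, hΨb, hΨpos, x, hx1, hx2⟩ := MappingCone.exists_positiveAt_of_isOfFinOrder γ hw hfin
  have hfr : Module.finrank ℝ (((Fin N → ℝ) × ℝ) × ℝ) = N + 2 := by simp
  obtain ⟨P, hP, u, hAP, hu₁, hu₂⟩ := exists_approx_avoiding hj₁ hj₂ (by omega) (by omega)
    ((MappingCone.continuous_pinch γ).comp e.invFun.continuous)
    (fun _ => MappingCone.pinch_ne_zero γ _)
    (e (MappingCone.incl γ w₀)).1 (e (MappingCone.incl γ w₀)).2
  have hu : u ≠ 0 := by simpa using hu₁ (e (MappingCone.incl γ w₀)).1 1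
  obtain ⟨H⟩ := homotopicWith_const_of_homotopyEquiv_prod (Classical.arbitrary _) e
    (MappingCone.continuous_pinch γ) (MappingCone.pinch_ne_zero γ) Ψ _ hΨb hP hAP hu₁ hu₂ hu
  have h0 : ∀ x, (H (0, x) : ((Fin N → ℝ) × ℝ) × ℝ) = MappingCone.pinch γ (Ψ x) := fun x =>
    congrArg Subtype.val (H.apply_zero x)
  have h1 : ∀ x, (H (1, x) : ((Fin N → ℝ) × ℝ) × ℝ) = u := fun x =>
    congrArg Subtype.val (H.apply_one x)
  have key := snd_eq_one_of_forall_positiveAt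
    (H := fun p => (H p : ((Fin N → ℝ) × ℝ) × ℝ)) (continuous_subtype_val.comp H.continuous)
    (by simpa only [h0] using hΨpos) (fun p => (H p).2)
    (fun x hx => by rw [h0, hΨb x hx]; rfl)
    (fun s x hx y hy => congrArg Subtype.val (H.prop' s x hx y hy))
    (fun x y => by rw [h1, h1]) x (by rwa [h0])
  rw [h0] at key
  exact hx2 key

end Main

/-!
STATEMENT 4.  Let `m, n ≥ 2` (below `m = m' + 2`, `n = n' + 2`), let `W = S^m ∨ S^n` with the
two sphere inclusions `i₁, i₂`, and let `w ∈ π_{m+n-1}(W)` be the Whitehead product `[i₁,i₂]`,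
characterized by the property that the mapping cone of (a representative `γ` of) `w` is
`S^m × S^n ≃ (S^m ∨ S^n) ∪_{[i₁,i₂]} e^{m+n}` compatibly with the inclusions (hypotheses
`hcone`, `hcompat₁`, `hcompat₂`).  If `w` had finite order, then rationally
`S^m × S^n ≃_ℚ S^m ∨ S^n ∨ S^{m+n}`, which contradicts the cup-product structure of
`H^*(S^m × S^n; ℚ)`.  Hence `w` has infinite order in `π_{m+n-1}(S^m ∨ S^n)`. -/
theorem stmt4 (m' n' : ℕ)
    (p₀ : Sph (m' + 2)) (q₀ : Sph (n' + 2))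
    (w : π_ (m' + n' + 3) (Wedge (Sph (m' + 2)) (Sph (n' + 2)) p₀ q₀) (Wedge.pt p₀ q₀))
    (γ : GenLoop (Fin (m' + n' + 3))
      (Wedge (Sph (m' + 2)) (Sph (n' + 2)) p₀ q₀) (Wedge.pt p₀ q₀))
    (hγ : Quotient.mk _ γ = w)
    (e : ContinuousMap.HomotopyEquiv (MappingCone γ) (Sph (m' + 2) × Sph (n' + 2)))
    (hcompat₁ : ∀ a : Sph (m' + 2),
      e.toFun (MappingCone.incl γ (Wedge.inl p₀ q₀ a)) = (a, q₀))
    (hcompat₂ : ∀ b : Sph (n' + 2),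
      e.toFun (MappingCone.incl γ (Wedge.inr p₀ q₀ b)) = (p₀, b)) :
    ¬ IsOfFinOrder w := by
  have hcs : ∀ k, CompactSpace (Sph k) := fun k =>
    inferInstanceAs (CompactSpace (Metric.sphere (0 : EuclideanSpace ℝ (Fin (k + 1))) 1))
  have := hcs (m' + 2)
  have := hcs (n' + 2)
  have hj : ∀ k, Topology.IsClosedEmbedding
      (fun x : Sph k => (Subtype.val x : EuclideanSpace ℝ (Fin (k + 1)))) := fun k =>
    Metric.isClosed_sphere.isClosedEmbedding_subtypeVal
  exact not_isOfFinOrder_of_homotopyEquiv_prod γ hγ (hj _) (hj _)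
    (by simp) (by simp) e
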